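/- arXiv:2509.24538 — 2 statements merged into one kernel-verified Lean document; each statement's English description precedes it below -/
import Mathlib

section
/- For each N let A_N be Haar-distributed on O(N), embedded into ℝ^{ℕ×ℕ} by padding with zeros and equipping ℝ^{ℕ×ℕ} with the product topology. Let β_N be a sequence of positive reals with β_N → ∞ and β_N = o(√N). Then β_N·A_N satisfies a large deviation principle on ℝ^{ℕ×ℕ} with speed N/β_N² and good convex rate function J(A) = (1/2)·∑_{i,j=1}^∞ A_{i,j}² (equal to +∞ if the entries of A are not square-summable); that is, for every open O ⊆ ℝ^{ℕ×ℕ}, liminf_{N→∞} (β_N²/N)·log ℙ(β_N·A_N ∈ O) ≥ −inf_{A∈O} J(A), and for every closed C ⊆ ℝ^{ℕ×ℕ}, limsup_{N→∞} (β_N²/N)·log ℙ(β_N·A_N ∈ C) ≤ −inf_{A∈C} J(A). -/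
open MeasureTheory Filter Matrix Asymptotics

noncomputable instance matrixMeasurableSpace {N : ℕ} :
    MeasurableSpace (Matrix (Fin N) (Fin N) ℝ) :=
  show MeasurableSpace (Fin N → Fin N → ℝ) from inferInstance

/-- An `N × N` matrix embedded into `ℝ^{ℕ × ℕ}` by padding with zeros. -/
def matEmb {N : ℕ} (A : Matrix (Fin N) (Fin N) ℝ) : ℕ → ℕ → ℝ :=
  fun i j => if h : i < N ∧ j < N then A ⟨i, h.1⟩ ⟨j, h.2⟩ else 0

open scoped Classical in
/-- The good convex rate function `J(A) = (1/2) ∑_{i,j} A_{i,j}²` on `ℝ^{ℕ × ℕ}`,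
equal to `+∞` if the entries are not square-summable. -/
noncomputable def rateJ (A : ℕ → ℕ → ℝ) : EReal :=
  if Summable (fun p : ℕ × ℕ => (A p.1 p.2) ^ 2) then
    (((1 : ℝ) / 2) * ∑' p : ℕ × ℕ, (A p.1 p.2) ^ 2 : ℝ)
  else ⊤

section OrthogonalModerateDeviations

open ProbabilityTheory

/-- The law of an `m × n` matrix with independent standard Gaussian entries. -/
noncomputable def gaussMat (m n : ℕ) : Measure (Fin m → Fin n → ℝ) :=
  Measure.pi fun _ => Measure.pi fun _ => gaussianReal 0 1

instance (m n : ℕ) : IsProbabilityMeasure (gaussMat m n) := by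
  unfold gaussMat; infer_instance

lemma gaussMat_eq_map (m n : ℕ) :
    gaussMat m n = (stdGaussian (EuclideanSpace ℝ (Fin m × Fin n))).map
      (fun x i j => x (i, j)) := by
  have h := Measure.infinitePi_map_curry (ι := Fin m) (κ := Fin n)
    (μ := fun _ _ => gaussianReal 0 1)
  simp only [Measure.infinitePi_eq_pi] at h
  rw [gaussMat, ← h, ← map_pi_eq_stdGaussian, Measure.map_map (by fun_prop) (by fun_prop)]
  rfl

lemma gaussMat_map_mul {m n : ℕ} (A : Matrix (Fin m) (Fin m) ℝ) (hA : A * Aᵀ = 1) :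
    (gaussMat m n).map (fun G i j => ∑ b, A i b * G b j) = gaussMat m n := by
  have hA' : Aᵀ * A = 1 := mul_eq_one_comm.mp hA
  let f : EuclideanSpace ℝ (Fin m × Fin n) →ₗ[ℝ] EuclideanSpace ℝ (Fin m × Fin n) :=
    { toFun := fun x => WithLp.toLp 2 fun p => ∑ b, A p.1 b * x (b, p.2)
      map_add' := fun x y => by
        ext p; simp [mul_add, Finset.sum_add_distrib]
      map_smul' := fun c x => by
        ext p; simp [Finset.mul_sum, mul_left_comm] }
  have hf : ∀ x, ‖f x‖ = ‖x‖ := by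
    intro x
    rw [EuclideanSpace.norm_eq, EuclideanSpace.norm_eq]
    congr 1
    simp only [Real.norm_eq_abs, sq_abs, Fintype.sum_prod_type_right]
    refine Finset.sum_congr rfl fun j _ => ?_
    have : (A *ᵥ fun b => x (b, j)) ⬝ᵥ (A *ᵥ fun b => x (b, j)) =
        (fun b => x (b, j)) ⬝ᵥ (fun b => x (b, j)) := by
      rw [Matrix.dotProduct_mulVec, Matrix.vecMul_mulVec, ← Matrix.dotProduct_mulVec, hA',
        Matrix.one_mulVec]
    simpa [dotProduct, mulVec, sq, f] using this
  let e : EuclideanSpace ℝ (Fin m × Fin n) ≃ₗᵢ[ℝ] EuclideanSpace ℝ (Fin m × Fin n) :=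
    LinearIsometry.toLinearIsometryEquiv ⟨f, hf⟩ rfl
  have he := stdGaussian_map e
  have hm : Measurable fun (G : Fin m → Fin n → ℝ) i j => ∑ b, A i b * G b j := by fun_prop
  rw [gaussMat_eq_map, Measure.map_map hm (by fun_prop)]
  conv_rhs => rw [← he, Measure.map_map (by fun_prop) (by fun_prop)]
  rfl

lemma gaussMat_map_corner {k m : ℕ} (h : k ≤ m) (n : ℕ) :
    (gaussMat m n).map (fun G i => G (Fin.castLE h i)) = gaussMat k n := by
  have h1 : iIndepFun (fun (a : Fin m) (G : Fin m → Fin n → ℝ) => G a) (gaussMat m n) :=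
    iIndepFun_pi (X := fun _ x => x) fun _ => aemeasurable_id
  have h2 := h1.precomp (Fin.castLE_injective h)
  rw [iIndepFun_iff_map_fun_eq_pi_map (fun i => by
    exact (measurable_pi_apply _).aemeasurable)] at h2
  rw [h2, gaussMat]
  congr 1
  funext i
  exact (measurePreserving_eval (fun _ : Fin m => Measure.pi fun _ : Fin n => gaussianReal 0 1)
    (Fin.castLE h i)).map_eq

lemma integrable_exp_mul_sq_gaussianReal {t : ℝ} (ht : t < 1 / 2) :
    Integrable (fun x : ℝ => Real.exp (t * x ^ 2)) (gaussianReal 0 1) := by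
  rw [gaussianReal_of_var_ne_zero _ one_ne_zero, gaussianPDF_def,
    integrable_withDensity_iff (by fun_prop) (by simp)]
  have h := (integrable_exp_neg_mul_sq (b := 1 / 2 - t) (by linarith)).const_mul
    (√(2 * Real.pi))⁻¹
  refine h.congr (ae_of_all _ fun x => ?_)
  simp only [gaussianPDFReal, NNReal.coe_one, mul_one, sub_zero]
  rw [ENNReal.toReal_ofReal (by positivity), mul_left_comm, ← Real.exp_add]
  congr 2; ring

lemma gaussMat_sum_sq_ge_le (k : ℕ) {t : ℝ} (ht0 : 0 ≤ t) (ht : t < 1) :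
    ∃ C : ℝ, 0 < C ∧ ∀ r : ℝ, (gaussMat k k).real {G | r ≤ ∑ i, ∑ j, G i j ^ 2} ≤
      C * Real.exp (-(t / 2) * r) := by
  set S : (Fin k → Fin k → ℝ) → ℝ := fun G => ∑ i, ∑ j, G i j ^ 2 with hS
  have hint : Integrable (fun G => Real.exp (t / 2 * S G)) (gaussMat k k) := by
    have h1 : Integrable (fun x : Fin k → ℝ => ∏ j, Real.exp (t / 2 * x j ^ 2))
        (Measure.pi fun _ : Fin k => gaussianReal 0 1) :=
      Integrable.fintype_prod (f := fun _ x => Real.exp (t / 2 * x ^ 2)) fun _ =>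
        integrable_exp_mul_sq_gaussianReal (by linarith)
    have hpi : ∀ (ρ : Measure (Fin k → ℝ)) [IsProbabilityMeasure ρ] (f : (Fin k → ℝ) → ℝ),
        Integrable f ρ → Integrable (fun G : Fin k → Fin k → ℝ => ∏ i, f (G i))
          (Measure.pi fun _ => ρ) :=
      fun ρ _ f hf => Integrable.fintype_prod (f := fun _ => f) fun _ => hf
    have h2 := hpi _ _ h1
    refine h2.congr (ae_of_all _ fun G => ?_)
    simp [hS, Finset.mul_sum, Real.exp_sum]
  refine ⟨mgf S (gaussMat k k) (t / 2), mgf_pos hint, fun r => ?_⟩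
  rw [mul_comm]
  exact measure_ge_le_exp_mul_mgf r (by linarith) hint

lemma exp_le_gaussianReal_ball (x : ℝ) {δ : ℝ} (hδ : 0 < δ) {s : ℝ}
    (hs : √(2 * Real.pi) / (2 * δ) ≤ s) :
    Real.exp (-s ^ 2 * ((|x| + δ) ^ 2 / 2)) ≤
      (gaussianReal 0 1).real {y | |y - s * x| < s * δ} := by
  have hs0 : 0 < s := lt_of_lt_of_le (by positivity) hs
  have hset : {y | |y - s * x| < s * δ} = Set.Ioo (s * x - s * δ) (s * x + s * δ) := by
    ext y; simp only [Set.mem_ofPred_eq, Set.mem_Ioo, abs_lt]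
    constructor <;> rintro ⟨h1, h2⟩ <;> constructor <;> linarith
  rw [hset, measureReal_def, gaussianReal_apply_eq_integral _ one_ne_zero,
    ENNReal.toReal_ofReal (integral_nonneg fun y => gaussianPDFReal_nonneg _ _ _)]
  set c := (√(2 * Real.pi))⁻¹ * Real.exp (-s ^ 2 * ((|x| + δ) ^ 2 / 2)) with hc
  have h1 : ∫ _y in Set.Ioo (s * x - s * δ) (s * x + s * δ), c ≤
      ∫ y in Set.Ioo (s * x - s * δ) (s * x + s * δ), gaussianPDFReal 0 1 y := by
    refine setIntegral_mono_on (integrableOn_const (by simp))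
      (integrable_gaussianPDFReal 0 1).integrableOn measurableSet_Ioo fun y hy => ?_
    simp only [gaussianPDFReal, NNReal.coe_one, mul_one, sub_zero, hc]
    gcongr
    have hy' : |y| ≤ s * (|x| + δ) := by
      rw [abs_le]
      have := mul_le_mul_of_nonneg_left (neg_abs_le x) hs0.le
      have := mul_le_mul_of_nonneg_left (le_abs_self x) hs0.le
      constructor <;> nlinarith [hy.1, hy.2]
    have : y ^ 2 ≤ (s * (|x| + δ)) ^ 2 := by
      rw [← sq_abs y]; gcongr
    nlinarith
  refine le_trans ?_ h1
  rw [setIntegral_const, smul_eq_mul]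
  have h2 : volume.real (Set.Ioo (s * x - s * δ) (s * x + s * δ)) = 2 * s * δ := by
    rw [Measure.real, Real.volume_Ioo, ENNReal.toReal_ofReal (by nlinarith)]
    ring
  rw [h2, hc, ← mul_assoc]
  refine le_mul_of_one_le_left (Real.exp_pos _).le ?_
  rw [← div_eq_mul_inv, le_div_iff₀ (by positivity)]
  rw [div_le_iff₀ (by positivity)] at hs
  linarith

lemma exp_le_gaussMat_box (k : ℕ) (x : Fin k → Fin k → ℝ) {δ : ℝ} (hδ : 0 < δ) {s : ℝ}
    (hs : √(2 * Real.pi) / (2 * δ) ≤ s) :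
    Real.exp (-s ^ 2 * ∑ i, ∑ j, (|x i j| + δ) ^ 2 / 2) ≤
      (gaussMat k k).real {G | ∀ i j, |G i j - s * x i j| < s * δ} := by
  have hset : {G : Fin k → Fin k → ℝ | ∀ i j, |G i j - s * x i j| < s * δ} =
      Set.univ.pi fun i => Set.univ.pi fun j => {y | |y - s * x i j| < s * δ} := by
    ext G; simp
  rw [hset, measureReal_def, gaussMat, Measure.pi_pi, ENNReal.toReal_prod]
  simp only [Measure.pi_pi, ENNReal.toReal_prod, Finset.mul_sum, Real.exp_sum]
  exact Finset.prod_le_prod (fun _ _ => by positivity) fun i _ =>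
    Finset.prod_le_prod (fun _ _ => by positivity) fun j _ => exp_le_gaussianReal_ball _ hδ hs

lemma pi_sum_ge_le_exp {α : Type*} [MeasurableSpace α] (ρ : Measure α) [IsProbabilityMeasure ρ]
    {Y : α → ℝ} (hint : 0 ∈ interior (integrableExpSet Y ρ))
    (hmean : ∫ x, Y x ∂ρ = 0) {η : ℝ} (hη : 0 < η) :
    ∃ c : ℝ, 0 < c ∧ ∀ N : ℕ, (Measure.pi fun _ : Fin N => ρ).real
      {G | η * N ≤ ∑ a, Y (G a)} ≤ Real.exp (-c * N) := by
  obtain ⟨t, ht0, htm, ht1⟩ : ∃ t : ℝ, 0 < t ∧ t ∈ integrableExpSet Y ρ ∧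
      Real.exp (-t * η) * mgf Y ρ t < 1 := by
    have hd : HasDerivAt (fun t => Real.exp (-t * η) * mgf Y ρ t) (-η) 0 := by
      have h1 := hasDerivAt_mgf hint
      simp only [zero_mul, Real.exp_zero, mul_one, hmean] at h1
      have h2 : HasDerivAt (fun t : ℝ => Real.exp (-t * η)) (-η) 0 := by
        have := (((hasDerivAt_id (0 : ℝ)).neg.mul_const η)).exp
        simpa using this
      have h3 : HasDerivAt (fun t => Real.exp (-t * η) * mgf Y ρ t) _ 0 := h2.mul h1
      convert h3 using 1
      simp
    have h0 : Real.exp (-0 * η) * mgf Y ρ 0 = 1 := by simp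
    have hs := hasDerivAt_iff_tendsto_slope.1 hd
    have hneg : ∀ᶠ t in nhdsWithin (0 : ℝ) (Set.Ioi 0),
        slope (fun t => Real.exp (-t * η) * mgf Y ρ t) 0 t < 0 :=
      (hs.mono_left (nhdsWithin_mono _ fun x hx => ne_of_gt hx)).eventually_lt_const
        (by linarith)
    have hmem : ∀ᶠ t in nhdsWithin (0 : ℝ) (Set.Ioi 0), t ∈ integrableExpSet Y ρ :=
      nhdsWithin_le_nhds (mem_interior_iff_mem_nhds.1 hint)
    obtain ⟨t, h1, h2, h3⟩ := (hneg.and (hmem.and self_mem_nhdsWithin)).exists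
    refine ⟨t, h3, h2, ?_⟩
    have h3' : (0 : ℝ) < t := h3
    rw [slope_def_field, h0, sub_zero, div_lt_iff₀ h3'] at h1
    linarith
  have hpos : 0 < Real.exp (-t * η) * mgf Y ρ t := mul_pos (Real.exp_pos _) (mgf_pos htm)
  refine ⟨-Real.log (Real.exp (-t * η) * mgf Y ρ t), by
    have := Real.log_neg hpos ht1; linarith, fun N => ?_⟩
  have h1 := measure_ge_le_exp_mul_mgf (μ := Measure.pi fun _ : Fin N => ρ)
    (X := fun G => ∑ a, Y (G a)) (η * N) ht0.le (by
      simp only [Finset.mul_sum, Real.exp_sum]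
      exact Integrable.fintype_prod (μ := fun _ : Fin N => ρ)
        (f := fun _ x => Real.exp (t * Y x)) fun _ => htm)
  refine h1.trans (le_of_eq ?_)
  have h2 : mgf (fun G : Fin N → α => ∑ a, Y (G a)) (Measure.pi fun _ : Fin N => ρ) t =
      mgf Y ρ t ^ N := by
    simp only [mgf, Finset.mul_sum, Real.exp_sum]
    rw [integral_fintype_prod_eq_pow (ι := Fin N) (fun x => Real.exp (t * Y x)), Fintype.card_fin]
  rw [h2, neg_neg, mul_comm (Real.log _), Real.exp_nat_mul, Real.exp_log hpos, mul_pow,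
    ← Real.exp_nat_mul]
  congr 2; ring

lemma zero_mem_interior_integrableExpSet_mul {k : ℕ} (i j : Fin k) (c σ : ℝ) (hσ : |σ| ≤ 1) :
    0 ∈ interior (integrableExpSet (fun x : Fin k → ℝ => σ * (x i * x j - c))
      (Measure.pi fun _ => gaussianReal 0 1)) := by
  rw [mem_interior_iff_mem_nhds]
  filter_upwards [Metric.ball_mem_nhds (0 : ℝ) (show (0 : ℝ) < 1 / 2 by norm_num)] with t ht
  rw [mem_ball_zero_iff, Real.norm_eq_abs] at ht
  have h1 : ∀ l : Fin k, Integrable (fun x : Fin k → ℝ => Real.exp (|t| * x l ^ 2))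
      (Measure.pi fun _ => gaussianReal 0 1) := fun l =>
    (measurePreserving_eval (fun _ : Fin k => gaussianReal 0 1) l).integrable_comp_of_integrable
      (integrable_exp_mul_sq_gaussianReal ht)
  have h2 := ((h1 i).add (h1 j)).const_mul (Real.exp (-(t * σ * c)))
  refine h2.mono' (Measurable.aestronglyMeasurable (by fun_prop)) (ae_of_all _ fun x => ?_)
  rw [Real.norm_eq_abs, Real.abs_exp]
  have h3 : t * σ * (x i * x j) ≤ |t| * (max (x i ^ 2) (x j ^ 2)) := by
    calc t * σ * (x i * x j) ≤ |t * σ * (x i * x j)| := le_abs_self _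
      _ = |t| * (|σ| * (|x i| * |x j|)) := by rw [abs_mul, abs_mul, abs_mul, mul_assoc]
      _ ≤ |t| * (max (x i ^ 2) (x j ^ 2)) := by
        gcongr
        have h4 : |x i| * |x j| ≤ max (x i ^ 2) (x j ^ 2) := by
          rw [← sq_abs (x i), ← sq_abs (x j)]
          rcases le_total (|x i|) (|x j|) with h | h
          · exact le_max_of_le_right (by nlinarith [abs_nonneg (x i)])
          · exact le_max_of_le_left (by nlinarith [abs_nonneg (x j)])
        have : 0 ≤ |x i| * |x j| := by positivity
        nlinarith [abs_nonneg σ]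
  calc Real.exp (t * (σ * (x i * x j - c)))
      = Real.exp (-(t * σ * c)) * Real.exp (t * σ * (x i * x j)) := by
        rw [← Real.exp_add]; congr 1; ring
    _ ≤ Real.exp (-(t * σ * c)) * Real.exp (|t| * (max (x i ^ 2) (x j ^ 2))) := by gcongr
    _ ≤ _ := by
        gcongr
        rcases le_total (x i ^ 2) (x j ^ 2) with h | h
        · simp [max_eq_right h, (Real.exp_pos _).le]
        · simp [max_eq_left h, (Real.exp_pos _).le]

lemma integral_mul_pi_gaussianReal {k : ℕ} (i j : Fin k) :
    ∫ x : Fin k → ℝ, x i * x j ∂(Measure.pi fun _ => gaussianReal 0 1) =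
      if i = j then 1 else 0 := by
  have he : ∀ (l : Fin k) (f : ℝ → ℝ), AEStronglyMeasurable f (gaussianReal 0 1) →
      ∫ x : Fin k → ℝ, f (x l) ∂(Measure.pi fun _ => gaussianReal 0 1) =
      ∫ y, f y ∂gaussianReal 0 1 := fun l f hf => by
    conv_rhs => rw [← (measurePreserving_eval (fun _ : Fin k => gaussianReal 0 1) l).map_eq]
    rw [integral_map]
    · exact (measurable_pi_apply _).aemeasurable
    · rwa [(measurePreserving_eval (fun _ : Fin k => gaussianReal 0 1) l).map_eq]
  split_ifs with h
  · subst h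
    have h1 := he i (fun y => y * y) (by fun_prop)
    have h2 := variance_id_gaussianReal (μ := 0) (v := 1)
    rw [variance_of_integral_eq_zero aemeasurable_id (by simp)] at h2
    simp only [id, NNReal.coe_one, sq] at h2
    rw [h1, h2]
  · have h1 : iIndepFun (fun (a : Fin k) (x : Fin k → ℝ) => x a)
        (Measure.pi fun _ => gaussianReal 0 1) :=
      iIndepFun_pi (X := fun _ x => x) fun _ => aemeasurable_id
    have h2 := (h1.indepFun h).integral_fun_mul_eq_mul_integral
      (measurable_pi_apply _).aestronglyMeasurable (measurable_pi_apply _).aestronglyMeasurable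
    rw [h2, he i (fun y => y) (by fun_prop), integral_id_gaussianReal, zero_mul]

lemma gaussMat_gram_concentration (k : ℕ) {η : ℝ} (hη : 0 < η) :
    ∃ c C : ℝ, 0 < c ∧ 0 < C ∧ ∀ N : ℕ, (gaussMat N k).real
      {G | ∃ i j, η * N ≤ |∑ a, (G a i * G a j - if i = j then 1 else 0)|} ≤
        C * Real.exp (-c * N) := by
  have h : ∀ p : Fin k × Fin k × Bool, ∃ c : ℝ, 0 < c ∧ ∀ N : ℕ, (gaussMat N k).real
      {G | η * N ≤ ∑ a, (if p.2.2 then 1 else -1) *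
        (G a p.1 * G a p.2.1 - if p.1 = p.2.1 then 1 else 0)} ≤ Real.exp (-c * N) := by
    rintro ⟨i, j, b⟩
    refine pi_sum_ge_le_exp _ (zero_mem_interior_integrableExpSet_mul i j _ _ ?_) ?_ hη
    · cases b <;> simp
    · rw [integral_const_mul, integral_sub, integral_mul_pi_gaussianReal]
      · simp
      · have h0 := zero_mem_interior_integrableExpSet_mul i j 0 1 (by simp)
        have := memLp_of_mem_interior_integrableExpSet h0 1
        simpa using this.integrable le_rfl
      · exact integrable_const _
  choose c hc0 hc using h
  have hk : ∃ c0 : ℝ, 0 < c0 ∧ ∀ p, c0 ≤ c p := by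
    rcases isEmpty_or_nonempty (Fin k × Fin k × Bool) with hE | hE
    · exact ⟨1, one_pos, fun p => hE.elim p⟩
    · obtain ⟨p, hp⟩ := Finite.exists_min c
      exact ⟨c p, hc0 p, hp⟩
  obtain ⟨c0, hc00, hc0'⟩ := hk
  refine ⟨c0, Fintype.card (Fin k × Fin k × Bool) + 1, hc00, by positivity, fun N => ?_⟩
  have hsub : {G : Fin N → Fin k → ℝ |
      ∃ i j, η * N ≤ |∑ a, (G a i * G a j - if i = j then 1 else 0)|} ⊆
      ⋃ p : Fin k × Fin k × Bool, {G | η * N ≤ ∑ a, (if p.2.2 then 1 else -1) *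
        (G a p.1 * G a p.2.1 - if p.1 = p.2.1 then 1 else 0)} := by
    rintro G ⟨i, j, hG⟩
    rw [Set.mem_iUnion]
    rcases le_abs.1 hG with h | h
    · exact ⟨(i, j, true), by simpa using h⟩
    · refine ⟨(i, j, false), ?_⟩
      simpa [← Finset.sum_neg_distrib] using h
  refine (measureReal_mono hsub).trans ((measureReal_iUnion_fintype_le _).trans ?_)
  refine (Finset.sum_le_card_nsmul Finset.univ _ (Real.exp (-c0 * N)) fun p _ => ?_).trans ?_
  · refine (hc p N).trans (Real.exp_le_exp.2 ?_)
    have := mul_le_mul_of_nonneg_right (hc0' p) (Nat.cast_nonneg (α := ℝ) N)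
    linarith
  · rw [nsmul_eq_mul, Finset.card_univ]
    gcongr
    linarith

lemma measurable_matrix_mul_left {N : ℕ} (B : Matrix (Fin N) (Fin N) ℝ) :
    Measurable fun A : Matrix (Fin N) (Fin N) ℝ => B * A := by
  change Measurable fun (A : Fin N → Fin N → ℝ) i j => ∑ b, B i b * A b j
  fun_prop

lemma measurable_matrix_mul_right {N : ℕ} (B : Matrix (Fin N) (Fin N) ℝ) :
    Measurable fun A : Matrix (Fin N) (Fin N) ℝ => A * B := by
  change Measurable fun (A : Fin N → Fin N → ℝ) i j => ∑ b, A i b * B b j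
  fun_prop

lemma measurable_matrix_transpose {N : ℕ} :
    Measurable fun A : Matrix (Fin N) (Fin N) ℝ => Aᵀ := by
  change Measurable fun (A : Fin N → Fin N → ℝ) i j => A j i
  fun_prop

/-- A left-invariant probability measure carried by the orthogonal group. -/
structure IsOrthogonalHaar {N : ℕ} (μ : Measure (Matrix (Fin N) (Fin N) ℝ)) : Prop where
  prob : IsProbabilityMeasure μ
  supp : μ {A | A * Aᵀ = 1} = 1
  map_mul_left : ∀ B : Matrix (Fin N) (Fin N) ℝ, B * Bᵀ = 1 → μ.map (fun A => B * A) = μ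

namespace IsOrthogonalHaar

variable {N : ℕ} {μ : Measure (Matrix (Fin N) (Fin N) ℝ)}

lemma ae_mul_transpose (h : IsOrthogonalHaar μ) : ∀ᵐ A ∂μ, A * Aᵀ = 1 := by
  have := h.prob
  have hm : MeasurableSet {A : Matrix (Fin N) (Fin N) ℝ | A * Aᵀ = 1} := by
    change MeasurableSet ((fun (A : Fin N → Fin N → ℝ) i j => ∑ b, A i b * A j b) ⁻¹'
      {fun i j => (1 : Matrix (Fin N) (Fin N) ℝ) i j})
    exact measurableSet_preimage (by fun_prop) (measurableSet_singleton _)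
  exact (mem_ae_iff_prob_eq_one hm).2 h.supp

lemma map_transpose (h : IsOrthogonalHaar μ) : μ.map (fun A => Aᵀ) = μ := by
  have := h.prob
  ext S hS
  rw [Measure.map_apply measurable_matrix_transpose hS]
  have hE : MeasurableSet {p : Matrix (Fin N) (Fin N) ℝ × Matrix (Fin N) (Fin N) ℝ |
      p.1ᵀ * p.2 ∈ S} := by
    refine hS.preimage ?_
    change Measurable fun (p : (Fin N → Fin N → ℝ) × (Fin N → Fin N → ℝ)) i j =>
      ∑ b, p.1 b i * p.2 b j
    fun_prop
  have h1 := Measure.prod_apply (μ := μ) (ν := μ) hE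
  rw [Measure.prod_apply_symm hE] at h1
  have h2 : ∀ᵐ C ∂μ, μ (Prod.mk C ⁻¹' {p : Matrix (Fin N) (Fin N) ℝ × Matrix (Fin N) (Fin N) ℝ |
      p.1ᵀ * p.2 ∈ S}) = μ S := by
    filter_upwards [h.ae_mul_transpose] with C hC
    have hC' : Cᵀ * Cᵀᵀ = 1 := by rw [transpose_transpose]; exact mul_eq_one_comm.mp hC
    conv_rhs => rw [← h.map_mul_left _ hC', Measure.map_apply (measurable_matrix_mul_left _) hS]
    rfl
  have h3 : ∀ᵐ A ∂μ, μ ((fun C => (C, A)) ⁻¹' {p : Matrix (Fin N) (Fin N) ℝ ×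
      Matrix (Fin N) (Fin N) ℝ | p.1ᵀ * p.2 ∈ S}) = μ ((fun A => Aᵀ) ⁻¹' S) := by
    filter_upwards [h.ae_mul_transpose] with A hA
    have hA' : Aᵀ * Aᵀᵀ = 1 := by rw [transpose_transpose]; exact mul_eq_one_comm.mp hA
    conv_rhs => rw [← h.map_mul_left _ hA', Measure.map_apply (measurable_matrix_mul_left _)
      (hS.preimage measurable_matrix_transpose)]
    congr 1
    ext C
    change Cᵀ * A ∈ S ↔ (Aᵀ * C)ᵀ ∈ S
    rw [transpose_mul, transpose_transpose]
  rw [lintegral_congr_ae h2, lintegral_congr_ae h3] at h1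
  simpa using h1

lemma map_mul_right (h : IsOrthogonalHaar μ) (B : Matrix (Fin N) (Fin N) ℝ) (hB : B * Bᵀ = 1) :
    μ.map (fun A => A * B) = μ := by
  have hB' : Bᵀ * Bᵀᵀ = 1 := by rw [transpose_transpose]; exact mul_eq_one_comm.mp hB
  conv_rhs => rw [← h.map_transpose, ← h.map_mul_left _ hB']
  conv_lhs => rw [← h.map_transpose]
  rw [Measure.map_map measurable_matrix_transpose (measurable_matrix_mul_left _),
    Measure.map_map (measurable_matrix_mul_right _) measurable_matrix_transpose]
  congr 1
  funext A
  change Aᵀ * B = (Bᵀ * A)ᵀ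
  rw [transpose_mul, transpose_transpose]

end IsOrthogonalHaar

lemma exists_orthogonal_extension {k N : ℕ} (h : k ≤ N) (V : Matrix (Fin N) (Fin k) ℝ)
    (hV : Vᵀ * V = 1) :
    ∃ B : Matrix (Fin N) (Fin N) ℝ, B * Bᵀ = 1 ∧ B.submatrix id (Fin.castLE h) = V := by
  classical
  let v : Fin N → EuclideanSpace ℝ (Fin N) := fun l =>
    if hl : (l : ℕ) < k then WithLp.toLp 2 fun b => V b ⟨l, hl⟩ else 0
  have hv : Orthonormal ℝ (Set.domRestrict {l : Fin N | (l : ℕ) < k} v) := by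
    rw [orthonormal_iff_ite]
    rintro ⟨l, hl⟩ ⟨m, hm⟩
    simp only [Set.mem_ofPred_eq] at hl hm
    have h1 := congr_fun (congr_fun hV ⟨m, hm⟩) ⟨l, hl⟩
    simp only [Matrix.mul_apply, Matrix.transpose_apply, Matrix.one_apply, Fin.mk.injEq] at h1
    simp only [Set.domRestrict_apply, v, dif_pos hl, dif_pos hm, Subtype.mk.injEq, Fin.ext_iff]
    simpa [PiLp.inner_apply, eq_comm, mul_comm] using h1
  obtain ⟨b, hb⟩ := hv.exists_orthonormalBasis_extension_of_card_eq (by simp)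
  refine ⟨Matrix.of fun i l => b l i, mul_eq_one_comm.mp ?_, ?_⟩
  · ext l m
    have h1 := orthonormal_iff_ite.1 b.orthonormal m l
    simpa [Matrix.mul_apply, PiLp.inner_apply, Matrix.one_apply, eq_comm] using h1
  · ext i l
    have h1 := hb (Fin.castLE h l) (by simp)
    simp [h1, v]

lemma exists_sqrt_near_one {k : ℕ} (S : Matrix (Fin k) (Fin k) ℝ) (hS : Sᵀ = S) {η : ℝ}
    (hη : ∀ i j, |(S - 1) i j| ≤ η) (hη1 : k ^ 2 * η ≤ 1) :
    ∃ T : Matrix (Fin k) (Fin k) ℝ, Tᵀ * T = S ∧ ∀ i j, |(T - 1) i j| ≤ k * (k ^ 2 * η) := by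
  have hH : S.IsHermitian := by
    rw [Matrix.IsHermitian, Matrix.conjTranspose_eq_transpose_of_trivial, hS]
  set l := hH.eigenvalues
  obtain ⟨U, hU1, hU2, hsp⟩ : ∃ U : Matrix (Fin k) (Fin k) ℝ, U * Uᵀ = 1 ∧ Uᵀ * U = 1 ∧
      S = U * diagonal l * Uᵀ := by
    refine ⟨hH.eigenvectorUnitary, ?_, ?_, ?_⟩
    · have := Unitary.mul_star_self_of_mem hH.eigenvectorUnitary.2
      rwa [Matrix.star_eq_conjTranspose, Matrix.conjTranspose_eq_transpose_of_trivial] at this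
    · have := Unitary.star_mul_self_of_mem hH.eigenvectorUnitary.2
      rwa [Matrix.star_eq_conjTranspose, Matrix.conjTranspose_eq_transpose_of_trivial] at this
    · have := hH.spectral_theorem
      simpa [Unitary.conjStarAlgAut_apply, Matrix.star_eq_conjTranspose,
        Matrix.conjTranspose_eq_transpose_of_trivial] using this
  have hUe : ∀ i j, |U i j| ≤ 1 := fun i j => by
    have h1 := congr_fun (congr_fun hU1 i) i
    simp only [Matrix.mul_apply, Matrix.transpose_apply, Matrix.one_apply_eq] at h1
    have h2 := Finset.single_le_sum (f := fun b => U i b * U i b)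
      (fun b _ => mul_self_nonneg _) (Finset.mem_univ j)
    rw [abs_le_one_iff_mul_self_le_one]
    linarith
  have hd : ∀ d : Fin k → ℝ, U * diagonal d * Uᵀ - 1 = U * diagonal (fun m => d m - 1) * Uᵀ :=
    fun d => by
      have : diagonal (fun m => d m - 1) = diagonal d - 1 := by
        rw [← Matrix.diagonal_one, Matrix.diagonal_sub]
      rw [this, mul_sub, sub_mul, mul_one, hU1]
  have hsub : S - 1 = U * diagonal (fun m => l m - 1) * Uᵀ := by
    rw [← hd, ← hsp]
  have hl : ∀ m, |l m - 1| ≤ k ^ 2 * η := fun m => by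
    have h1 : Uᵀ * (S - 1) * U = diagonal (fun m => l m - 1) := by
      rw [hsub, ← mul_assoc, ← mul_assoc, hU2, one_mul, mul_assoc, hU2, mul_one]
    have h2 := congr_fun (congr_fun h1 m) m
    rw [Matrix.diagonal_apply_eq] at h2
    rw [← h2, Matrix.mul_apply]
    have h3 : ∀ b, |(Uᵀ * (S - 1)) m b * U b m| ≤ k * η := fun b => by
      rw [abs_mul]
      refine (mul_le_of_le_one_right (abs_nonneg _) (hUe b m)).trans ?_
      rw [Matrix.mul_apply]
      refine (Finset.abs_sum_le_sum_abs _ _).trans ?_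
      refine (Finset.sum_le_card_nsmul Finset.univ _ η fun a _ => ?_).trans (by simp)
      rw [abs_mul]
      exact (mul_le_of_le_one_left (abs_nonneg _) (hUe a m)).trans (hη a b)
    refine (Finset.abs_sum_le_sum_abs _ _).trans ?_
    refine (Finset.sum_le_card_nsmul Finset.univ _ _ fun b _ => h3 b).trans ?_
    simp only [Finset.card_univ, Fintype.card_fin, nsmul_eq_mul]
    exact le_of_eq (by ring)
  have hl0 : ∀ m, 0 ≤ l m := fun m => by
    have := (abs_le.1 ((hl m).trans hη1)).1
    linarith
  have hsq : ∀ m, |√(l m) - 1| ≤ k ^ 2 * η := fun m => by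
    refine le_trans ?_ (hl m)
    have h1 : l m - 1 = (√(l m) - 1) * (√(l m) + 1) := by
      nlinarith [Real.mul_self_sqrt (hl0 m)]
    rw [h1, abs_mul]
    refine le_mul_of_one_le_right (abs_nonneg _) ?_
    rw [abs_of_nonneg (by positivity)]
    linarith [Real.sqrt_nonneg (l m)]
  refine ⟨U * diagonal (fun m => √(l m)) * Uᵀ, ?_, fun i j => ?_⟩
  · have : ∀ D : Matrix (Fin k) (Fin k) ℝ, U * D * Uᵀ * (U * D * Uᵀ) = U * (D * D) * Uᵀ :=
      fun D => by
        calc U * D * Uᵀ * (U * D * Uᵀ) = U * D * (Uᵀ * U) * D * Uᵀ := by simp only [mul_assoc]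
          _ = _ := by rw [hU2]; simp only [mul_assoc, mul_one]
    have hT : (U * diagonal (fun m => √(l m)) * Uᵀ)ᵀ = U * diagonal (fun m => √(l m)) * Uᵀ := by
      simp [Matrix.transpose_mul, mul_assoc]
    rw [hT, this, Matrix.diagonal_mul_diagonal, hsp]
    simp only [Real.mul_self_sqrt (hl0 _)]
  · rw [hd, Matrix.mul_apply]
    refine (Finset.abs_sum_le_sum_abs _ _).trans ?_
    refine (Finset.sum_le_card_nsmul Finset.univ _ (k ^ 2 * η) fun m _ => ?_).trans (by simp)
    rw [Matrix.mul_diagonal, Matrix.transpose_apply, abs_mul, abs_mul]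
    refine (mul_le_of_le_one_right (by positivity) (hUe j m)).trans ?_
    exact (mul_le_of_le_one_left (abs_nonneg _) (hUe i m)).trans (hsq m)

/-- The upper left `k × k` block of an `N × N` matrix. -/
def corner {k N : ℕ} (h : k ≤ N) (A : Matrix (Fin N) (Fin N) ℝ) : Matrix (Fin k) (Fin k) ℝ :=
  A.submatrix (Fin.castLE h) (Fin.castLE h)

lemma measurable_corner {k N : ℕ} (h : k ≤ N) : Measurable (corner h) := by
  change Measurable fun (A : Fin N → Fin N → ℝ) i j => A (Fin.castLE h i) (Fin.castLE h j)
  fun_prop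

namespace IsOrthogonalHaar

variable {k N : ℕ} {μ : Measure (Matrix (Fin N) (Fin N) ℝ)}

lemma gaussMat_eq_lintegral (h : IsOrthogonalHaar μ) (hk : k ≤ N) {S : Set (Fin k → Fin k → ℝ)}
    (hS : MeasurableSet S) :
    gaussMat k k S = ∫⁻ G, μ {A | (fun i j => ∑ b, A (Fin.castLE hk i) b * G b j) ∈ S}
      ∂gaussMat N k := by
  have := h.prob
  have hE : MeasurableSet {p : Matrix (Fin N) (Fin N) ℝ × (Fin N → Fin k → ℝ) |
      (fun i j => ∑ b, p.1 (Fin.castLE hk i) b * p.2 b j) ∈ S} := by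
    refine hS.preimage ?_
    change Measurable fun (p : (Fin N → Fin N → ℝ) × (Fin N → Fin k → ℝ)) i j =>
      ∑ b, p.1 (Fin.castLE hk i) b * p.2 b j
    fun_prop
  have h1 := Measure.prod_apply (μ := μ) (ν := gaussMat N k) hE
  rw [Measure.prod_apply_symm hE] at h1
  refine Eq.trans ?_ h1.symm
  have h2 : ∀ᵐ A ∂μ, gaussMat N k (Prod.mk A ⁻¹' {p : Matrix (Fin N) (Fin N) ℝ ×
      (Fin N → Fin k → ℝ) | (fun i j => ∑ b, p.1 (Fin.castLE hk i) b * p.2 b j) ∈ S}) =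
      gaussMat k k S := by
    filter_upwards [h.ae_mul_transpose] with A hA
    have hm : Measurable fun (G : Fin N → Fin k → ℝ) i => G (Fin.castLE hk i) := by fun_prop
    conv_rhs => rw [← gaussMat_map_corner hk, Measure.map_apply hm hS, ← gaussMat_map_mul A hA,
      Measure.map_apply (by fun_prop) (hS.preimage hm)]
    rfl
  rw [lintegral_congr_ae h2]
  simp

lemma measure_mul_eq (h : IsOrthogonalHaar μ) (hk : k ≤ N) (G : Matrix (Fin N) (Fin k) ℝ)
    {T : Matrix (Fin k) (Fin k) ℝ} (hT : Tᵀ * T = Gᵀ * G) (hu : IsUnit T.det)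
    {S : Set (Fin k → Fin k → ℝ)} (hS : MeasurableSet S) :
    μ {A | (fun i j => ∑ b, A (Fin.castLE hk i) b * G b j) ∈ S} =
      μ {A | (fun i j => (corner hk A * T) i j) ∈ S} := by
  have hV : (G * T⁻¹)ᵀ * (G * T⁻¹) = 1 := by
    calc (G * T⁻¹)ᵀ * (G * T⁻¹) = T⁻¹ᵀ * (Gᵀ * G) * T⁻¹ := by
          rw [transpose_mul]; simp only [Matrix.mul_assoc]
      _ = (T * T⁻¹)ᵀ * (T * T⁻¹) := by
          rw [← hT, transpose_mul]; simp only [Matrix.mul_assoc]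
      _ = 1 := by rw [Matrix.mul_nonsing_inv _ hu]; simp
  obtain ⟨B, hB, hBV⟩ := exists_orthogonal_extension hk _ hV
  have hG : G = B.submatrix id (Fin.castLE hk) * T := by
    rw [hBV, Matrix.mul_assoc, Matrix.nonsing_inv_mul _ hu, Matrix.mul_one]
  have hm : MeasurableSet {A : Matrix (Fin N) (Fin N) ℝ |
      (fun i j => (corner hk A * T) i j) ∈ S} := by
    refine hS.preimage ?_
    change Measurable fun (A : Fin N → Fin N → ℝ) i j =>
      ∑ b, A (Fin.castLE hk i) (Fin.castLE hk b) * T b j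
    fun_prop
  conv_rhs => rw [← h.map_mul_right B hB, Measure.map_apply (measurable_matrix_mul_right B) hm]
  congr 1
  ext A
  have : (fun i j => ∑ b, A (Fin.castLE hk i) b * G b j) =
      fun i j => (corner hk (A * B) * T) i j := by
    funext i j
    have h1 : corner hk (A * B) * T = A.submatrix (Fin.castLE hk) id * G := by
      rw [hG, ← Matrix.mul_assoc]
      rfl
    rw [h1]
    rfl
  change _ ∈ S ↔ _ ∈ S
  rw [this]

end IsOrthogonalHaar

section Frobenius

attribute [local instance] Matrix.frobeniusNormedRing Matrix.frobeniusNormedAlgebra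

lemma frobenius_norm_sq {k : ℕ} (A : Matrix (Fin k) (Fin k) ℝ) :
    ‖A‖ ^ 2 = ∑ i, ∑ j, A i j ^ 2 := by
  have h := Matrix.frobenius_norm_def A
  have h0 : 0 ≤ ∑ i, ∑ j, A i j ^ 2 :=
    Finset.sum_nonneg fun i _ => Finset.sum_nonneg fun j _ => sq_nonneg _
  rw [← Real.sqrt_eq_rpow] at h
  simp only [Real.rpow_two, Real.norm_eq_abs, sq_abs] at h
  exact (congrArg (· ^ 2) h).trans (Real.sq_sqrt h0)

lemma frobenius_norm_le_of_abs_le {k : ℕ} {A : Matrix (Fin k) (Fin k) ℝ} {e : ℝ} (he : 0 ≤ e)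
    (hA : ∀ i j, |A i j| ≤ e) : ‖A‖ ≤ k * e := by
  refine abs_le_of_sq_le_sq' ?_ (by positivity) |>.2
  rw [frobenius_norm_sq]
  refine (Finset.sum_le_sum fun i _ => Finset.sum_le_sum fun j _ =>
    sq_le_sq.2 ((hA i j).trans_eq (abs_of_nonneg he).symm)).trans_eq ?_
  simp
  ring

lemma abs_apply_le_frobenius_norm {k : ℕ} (A : Matrix (Fin k) (Fin k) ℝ) (i j : Fin k) :
    |A i j| ≤ ‖A‖ := by
  rw [← abs_of_nonneg (norm_nonneg A), ← sq_le_sq, frobenius_norm_sq]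
  exact (Finset.single_le_sum (f := fun j => A i j ^ 2) (fun _ _ => sq_nonneg _)
    (Finset.mem_univ j)).trans (Finset.single_le_sum (f := fun i => ∑ j, A i j ^ 2)
      (fun _ _ => Finset.sum_nonneg fun _ _ => sq_nonneg _) (Finset.mem_univ i))

lemma isUnit_det_of_frobenius_norm_sub_one_lt {k : ℕ} {T : Matrix (Fin k) (Fin k) ℝ}
    (hT : ‖T - 1‖ < 1) : IsUnit T.det := by
  rw [← Matrix.isUnit_iff_isUnit_det]
  have : CompleteSpace (Matrix (Fin k) (Fin k) ℝ) := FiniteDimensional.complete ℝ _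
  have h := isUnit_one_sub_of_norm_lt_one (x := 1 - T) (by rwa [norm_sub_rev])
  rwa [sub_sub_cancel] at h

lemma gaussMat_le_corner (k : ℕ) {ε : ℝ} (hε : 0 < ε) (hε1 : ε < 1) :
    ∃ c C, 0 < c ∧ 0 < C ∧ ∀ N : ℕ, 0 < N → ∀ hk : k ≤ N,
      ∀ μ : Measure (Matrix (Fin N) (Fin N) ℝ), IsOrthogonalHaar μ →
      ∀ S S' : Set (Fin k → Fin k → ℝ), MeasurableSet S →
      (∀ M T : Matrix (Fin k) (Fin k) ℝ, ‖T - 1‖ ≤ ε →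
        (fun i j => √N * (M * T) i j) ∈ S → (fun i j => M i j) ∈ S') →
      (gaussMat k k).real S ≤
        μ.real {A | (fun i j => corner hk A i j) ∈ S'} + C * Real.exp (-c * N) := by
  set η : ℝ := ε / (k ^ 4 + 1) with hη
  have hη0 : 0 < η := by positivity
  have hη4 : k ^ 4 * η ≤ ε := by
    rw [hη, mul_div_assoc', div_le_iff₀ (by positivity)]
    nlinarith
  have hη2 : k ^ 2 * η ≤ 1 := by
    rw [hη, mul_div_assoc', div_le_one (by positivity)]
    nlinarith [sq_nonneg ((k : ℝ) ^ 2 - 1), sq_nonneg (k : ℝ)]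
  obtain ⟨c, C, hc, hC, hbad⟩ := gaussMat_gram_concentration k hη0
  refine ⟨c, C, hc, hC, fun N hN hk μ hμ S S' hS hSS => ?_⟩
  have := hμ.prob
  set bad : Set (Fin N → Fin k → ℝ) :=
    {G | ∃ i j, η * N ≤ |∑ a, (G a i * G a j - if i = j then 1 else 0)|} with hbad_def
  have hN' : (0 : ℝ) < N := by exact_mod_cast hN
  have key : ∀ G : Fin N → Fin k → ℝ,
      μ {A | (fun i j => ∑ b, A (Fin.castLE hk i) b * G b j) ∈ S} ≤
        μ {A | (fun i j => corner hk A i j) ∈ S'} + bad.indicator (fun _ => 1) G := by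
    intro G
    by_cases hG : G ∈ bad
    · rw [Set.indicator_of_mem hG]
      exact prob_le_one.trans le_add_self
    rw [Set.indicator_of_notMem hG, add_zero]
    simp only [hbad_def, Set.mem_ofPred_eq, not_exists, not_le] at hG
    set Gm : Matrix (Fin N) (Fin k) ℝ := Matrix.of G
    obtain ⟨T, hT, hT1⟩ := exists_sqrt_near_one ((N : ℝ)⁻¹ • (Gmᵀ * Gm))
      (by rw [transpose_smul, transpose_mul, transpose_transpose]) (η := η) (fun i j => by
        have h1 := (hG i j).le
        have h2 : ((N : ℝ)⁻¹ • (Gmᵀ * Gm) - 1 : Matrix (Fin k) (Fin k) ℝ) i j =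
            (N : ℝ)⁻¹ * ∑ a, (G a i * G a j - if i = j then 1 else 0) := by
          rw [Finset.sum_sub_distrib, mul_sub]
          simp [Matrix.mul_apply, Gm, Matrix.one_apply, hN'.ne']
        rw [h2, abs_mul, abs_of_pos (inv_pos.2 hN'), inv_mul_le_iff₀ hN', mul_comm]
        exact h1) hη2
    have hTn : ‖T - 1‖ ≤ ε := by
      refine (frobenius_norm_le_of_abs_le (by positivity) hT1).trans (le_trans (le_of_eq ?_) hη4)
      ring
    have hu : IsUnit (√N • T).det := by
      rw [Matrix.det_smul]
      exact ((Real.sqrt_pos.2 hN').ne'.isUnit.pow _).mul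
        (isUnit_det_of_frobenius_norm_sub_one_lt (hTn.trans_lt hε1))
    have hTG : (√N • T)ᵀ * (√N • T) = Gmᵀ * Gm := by
      rw [transpose_smul, Matrix.smul_mul, Matrix.mul_smul, smul_smul,
        Real.mul_self_sqrt hN'.le, hT, smul_smul, mul_inv_cancel₀ hN'.ne', one_smul]
    refine (hμ.measure_mul_eq hk Gm hTG hu hS).trans_le (measure_mono fun A hA => ?_)
    refine hSS (corner hk A) T hTn ?_
    simpa only [Set.mem_ofPred_eq, Matrix.mul_smul, Matrix.smul_apply, smul_eq_mul] using hA
  have h1 : gaussMat k k S ≤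
      μ {A | (fun i j => corner hk A i j) ∈ S'} + gaussMat N k bad := by
    rw [hμ.gaussMat_eq_lintegral hk hS]
    refine (lintegral_mono key).trans ?_
    rw [lintegral_add_left measurable_const]
    refine add_le_add (by simp) ((lintegral_indicator_const_le _ _).trans (by simp))
  have h2 := ENNReal.toReal_mono (by finiteness) h1
  rw [ENNReal.toReal_add (by finiteness) (by finiteness)] at h2
  exact h2.trans (add_le_add le_rfl (hbad N))

lemma corner_le_gaussMat (k : ℕ) {ε : ℝ} (hε : 0 < ε) (hε1 : ε < 1) :
    ∃ c C, 0 < c ∧ 0 < C ∧ ∀ N : ℕ, 0 < N → ∀ hk : k ≤ N,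
      ∀ μ : Measure (Matrix (Fin N) (Fin N) ℝ), IsOrthogonalHaar μ →
      ∀ S S' : Set (Fin k → Fin k → ℝ), MeasurableSet S → MeasurableSet S' →
      (∀ M T : Matrix (Fin k) (Fin k) ℝ, ‖T - 1‖ ≤ ε →
        (fun i j => M i j) ∈ S' → (fun i j => √N * (M * T) i j) ∈ S) →
      μ.real {A | (fun i j => corner hk A i j) ∈ S'} ≤
        (gaussMat k k).real S + C * Real.exp (-c * N) := by
  obtain ⟨c, C, hc, hC, h⟩ := gaussMat_le_corner k hε hε1
  refine ⟨c, C, hc, hC, fun N hN hk μ hμ S S' hS hS' hSS => ?_⟩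
  have := hμ.prob
  have h1 := h N hN hk μ hμ Sᶜ S'ᶜ hS.compl fun M T hT hM hM' => hM (hSS M T hT hM')
  have h2 : {A | (fun i j => corner hk A i j) ∈ S'ᶜ} =
      {A | (fun i j => corner hk A i j) ∈ S'}ᶜ := rfl
  have h3 : MeasurableSet {A | (fun i j => corner hk A i j) ∈ S'} :=
    hS'.preimage (measurable_corner hk)
  rw [h2, probReal_compl_eq_one_sub hS, probReal_compl_eq_one_sub h3] at h1
  linarith

end Frobenius

section ExponentialScale

variable {v : ℕ → ℝ}

lemma eventually_mul_exp_le_half_exp (hv : Tendsto v atTop atTop) (C : ℝ) {a b : ℝ} (hab : a < b) :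
    ∀ᶠ N in atTop, C * Real.exp (-v N * b) ≤ 1 / 2 * Real.exp (-v N * a) := by
  have h1 : Tendsto (fun N => C * Real.exp (-(v N * (b - a)))) atTop (nhds (C * 0)) :=
    (Real.tendsto_exp_neg_atTop_nhds_zero.comp
      (hv.atTop_mul_const (sub_pos.2 hab))).const_mul C
  rw [mul_zero] at h1
  filter_upwards [h1.eventually_le_const (show (0 : ℝ) < 1 / 2 by norm_num)] with N hN
  calc C * Real.exp (-v N * b) = C * Real.exp (-(v N * (b - a))) * Real.exp (-v N * a) := by
        rw [mul_assoc, ← Real.exp_add]; ring_nf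
    _ ≤ _ := mul_le_mul_of_nonneg_right hN (Real.exp_pos _).le

lemma eventually_mul_exp_natCast_le_half_exp (hv : v =o[atTop] fun N => (N : ℝ)) {c : ℝ}
    (hc : 0 < c) (C a : ℝ) :
    ∀ᶠ N : ℕ in atTop, C * Real.exp (-c * N) ≤ 1 / 2 * Real.exp (-v N * a) := by
  have h1 := eventually_mul_exp_le_half_exp (v := fun N : ℕ => (N : ℝ))
    tendsto_natCast_atTop_atTop C (a := c / 2) (b := c) (by linarith)
  have h2 := (hv.const_mul_left a).bound (half_pos hc)
  filter_upwards [h1, h2] with N hN1 hN2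
  rw [Real.norm_eq_abs, Real.norm_natCast] at hN2
  calc C * Real.exp (-c * N) = C * Real.exp (-N * c) := by ring_nf
    _ ≤ 1 / 2 * Real.exp (-N * (c / 2)) := hN1
    _ ≤ _ := by
      refine mul_le_mul_of_nonneg_left (Real.exp_le_exp.2 ?_) (by norm_num)
      linarith [le_abs_self (a * v N)]

end ExponentialScale

section Moderate

attribute [local instance] Matrix.frobeniusNormedRing Matrix.frobeniusNormedAlgebra

variable {μ : (N : ℕ) → Measure (Matrix (Fin N) (Fin N) ℝ)} {β : ℕ → ℝ}

lemma isLittleO_natCast_div_sq (hβ_top : Tendsto β atTop atTop) :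
    (fun N : ℕ => (N : ℝ) / β N ^ 2) =o[atTop] fun N : ℕ => (N : ℝ) := by
  have h : Tendsto (fun N => (β N ^ 2)⁻¹) atTop (nhds 0) :=
    tendsto_inv_atTop_zero.comp ((tendsto_pow_atTop two_ne_zero).comp hβ_top)
  have := (isLittleO_one_iff ℝ).2 h
  simpa [div_eq_mul_inv] using (isBigO_refl (fun N : ℕ => (N : ℝ)) atTop).mul_isLittleO this

lemma tendsto_sqrt_div_atTop (hβ_pos : ∀ N, 0 < β N) (hβ_o : β =o[atTop] fun N : ℕ => √(N : ℝ)) :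
    Tendsto (fun N : ℕ => √(N : ℝ) / β N) atTop atTop := by
  have h1 : Tendsto (fun N : ℕ => β N / √(N : ℝ)) atTop (nhdsWithin 0 (Set.Ioi 0)) := by
    refine tendsto_nhdsWithin_iff.2 ⟨hβ_o.tendsto_div_nhds_zero, ?_⟩
    filter_upwards [eventually_gt_atTop 0] with N hN
    have : (0 : ℝ) < N := by exact_mod_cast hN
    exact div_pos (hβ_pos N) (Real.sqrt_pos.2 this)
  refine (tendsto_inv_nhdsGT_zero.comp h1).congr fun N => ?_
  simp [inv_div]

lemma tendsto_natCast_div_sq_atTop (hβ_pos : ∀ N, 0 < β N)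
    (hβ_o : β =o[atTop] fun N : ℕ => √(N : ℝ)) :
    Tendsto (fun N : ℕ => (N : ℝ) / β N ^ 2) atTop atTop := by
  refine ((tendsto_pow_atTop two_ne_zero).comp (tendsto_sqrt_div_atTop hβ_pos hβ_o)).congr
    fun N => ?_
  simp [div_pow]

/-- Upper bound for the mass of large upper left blocks on the moderate deviation scale. -/
lemma eventually_measure_sum_sq_ge_le (hμ : ∀ N, IsOrthogonalHaar (μ N)) (hβ_pos : ∀ N, 0 < β N)
    (hβ_top : Tendsto β atTop atTop) (hβ_o : β =o[atTop] fun N : ℕ => √(N : ℝ)) (k : ℕ)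
    {a m : ℝ} (ham : a < m) :
    ∀ᶠ N in atTop, ∀ hk : k ≤ N,
      (μ N).real {A | 2 * m ≤ ∑ i, ∑ j, (β N * corner hk A i j) ^ 2} ≤
        Real.exp (-(N / β N ^ 2) * a) := by
  obtain ⟨q, ⟨hq0, hq1⟩, hqm⟩ : ∃ q : ℝ, q ∈ Set.Ioo 0 1 ∧ a < q ^ 3 * m := by
    have h1 : Tendsto (fun q : ℝ => q ^ 3 * m) (nhdsWithin 1 (Set.Iio 1)) (nhds (1 ^ 3 * m)) :=
      (Continuous.tendsto (by fun_prop) 1).mono_left nhdsWithin_le_nhds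
    rw [one_pow, one_mul] at h1
    exact (Eventually.and (Ioo_mem_nhdsLT one_pos) (h1.eventually_const_lt ham)).exists
  obtain ⟨C₁, hC₁, h₁⟩ := gaussMat_sum_sq_ge_le k hq0.le hq1
  obtain ⟨c, C₂, hc, hC₂, h₂⟩ := corner_le_gaussMat k (ε := 1 - q) (by linarith) (by linarith)
  filter_upwards [eventually_gt_atTop 0,
    eventually_mul_exp_le_half_exp (tendsto_natCast_div_sq_atTop hβ_pos hβ_o) C₁ hqm,
    eventually_mul_exp_natCast_le_half_exp (isLittleO_natCast_div_sq hβ_top) hc C₂ a]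
    with N hN hN₁ hN₂ hk
  set r : ℝ := q ^ 2 * (2 * m) * (N / β N ^ 2) with hr
  have hβ := hβ_pos N
  have h3 := h₂ N hN hk (μ N) (hμ N) {G | r ≤ ∑ i, ∑ j, G i j ^ 2}
    {M | 2 * m ≤ ∑ i, ∑ j, (β N * M i j) ^ 2}
    (measurableSet_le measurable_const (by fun_prop))
    (measurableSet_le measurable_const (by fun_prop)) ?_
  · have h4 : C₁ * Real.exp (-(q / 2) * r) =
        C₁ * Real.exp (-(N / β N ^ 2) * (q ^ 3 * m)) := by
      rw [hr]; ring_nf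
    have h5 := h₁ r
    rw [h4] at h5
    refine h3.trans ?_
    linarith
  · intro M T hT hM
    have hMT : q * ‖M‖ ≤ ‖M * T‖ := by
      have h4 : ‖M‖ ≤ ‖M * T‖ + ‖M * (T - 1)‖ := by
        calc ‖M‖ = ‖M * T - M * (T - 1)‖ := by rw [mul_sub, mul_one, sub_sub_cancel]
          _ ≤ _ := norm_sub_le _ _
      have h5 := (norm_mul_le M (T - 1)).trans (mul_le_mul_of_nonneg_left hT (norm_nonneg M))
      linarith
    have hM' : 2 * m ≤ β N ^ 2 * ‖M‖ ^ 2 := by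
      rw [frobenius_norm_sq, Finset.mul_sum]
      simpa [Finset.mul_sum, mul_pow] using hM
    have h6 : ∑ i, ∑ j, (√N * (M * T) i j) ^ 2 = N * ‖M * T‖ ^ 2 := by
      rw [frobenius_norm_sq, Finset.mul_sum]
      simp [Finset.mul_sum, mul_pow]
    change r ≤ ∑ i, ∑ j, (√N * (M * T) i j) ^ 2
    rw [h6]
    calc r = N * q ^ 2 * ((2 * m) / β N ^ 2) := by rw [hr]; ring
      _ ≤ N * q ^ 2 * ‖M‖ ^ 2 := by
        gcongr
        rw [div_le_iff₀ (by positivity)]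
        linarith
      _ = N * (q * ‖M‖) ^ 2 := by ring
      _ ≤ _ := by gcongr

/-- Lower bound for the mass of small boxes on the moderate deviation scale. -/
lemma eventually_exp_le_measure_box (hμ : ∀ N, IsOrthogonalHaar (μ N)) (hβ_pos : ∀ N, 0 < β N)
    (hβ_top : Tendsto β atTop atTop) (hβ_o : β =o[atTop] fun N : ℕ => √(N : ℝ)) {k : ℕ}
    (x : Fin k → Fin k → ℝ) {r a : ℝ} (hr : 0 < r) (ha : ∑ i, ∑ j, x i j ^ 2 / 2 < a) :
    ∀ᶠ N in atTop, ∀ hk : k ≤ N, Real.exp (-(N / β N ^ 2) * a) ≤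
      (μ N).real {A | ∀ i j, |β N * corner hk A i j - x i j| < r} := by
  obtain ⟨δ, ⟨hδ0, hδr⟩, hδa⟩ : ∃ δ : ℝ, δ ∈ Set.Ioo 0 (r / 2) ∧
      ∑ i, ∑ j, (|x i j| + δ) ^ 2 / 2 < a := by
    have h1 : Tendsto (fun δ : ℝ => ∑ i, ∑ j, (|x i j| + δ) ^ 2 / 2) (nhdsWithin 0 (Set.Ioi 0))
        (nhds (∑ i, ∑ j, (|x i j| + 0) ^ 2 / 2)) :=
      (Continuous.tendsto (by fun_prop) 0).mono_left nhdsWithin_le_nhds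
    simp only [add_zero, sq_abs] at h1
    exact (Eventually.and (Ioo_mem_nhdsGT (half_pos hr)) (h1.eventually_lt_const ha)).exists
  set b := ∑ i, ∑ j, (|x i j| + δ) ^ 2 / 2 with hb
  set ε : ℝ := min (1 / 2) (r / (4 * √(2 * b) + 1)) with hε
  have hε0 : 0 < ε := lt_min (by norm_num) (by positivity)
  have hε1 : ε ≤ 1 / 2 := min_le_left _ _
  have hεr : ε * (2 * √(2 * b)) ≤ r / 2 := by
    have h1 : ε ≤ r / (4 * √(2 * b) + 1) := min_le_right _ _
    rw [le_div_iff₀ (by positivity)] at h1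
    linarith
  obtain ⟨c, C, hc, hC, h⟩ := gaussMat_le_corner k hε0 (by linarith)
  filter_upwards [eventually_gt_atTop 0,
    (tendsto_sqrt_div_atTop hβ_pos hβ_o).eventually_ge_atTop (√(2 * Real.pi) / (2 * δ)),
    eventually_mul_exp_le_half_exp (tendsto_natCast_div_sq_atTop hβ_pos hβ_o) 1 hδa,
    eventually_mul_exp_natCast_le_half_exp (isLittleO_natCast_div_sq hβ_top) hc C b]
    with N hN hNs hN₁ hN₂ hk
  have hβ := hβ_pos N
  have hN' : (0 : ℝ) < √N := Real.sqrt_pos.2 (by exact_mod_cast hN)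
  have hbox := exp_le_gaussMat_box k x hδ0 hNs
  rw [div_pow, Real.sq_sqrt (Nat.cast_nonneg N), ← hb] at hbox
  have h3 := h N hN hk (μ N) (hμ N)
    {G | ∀ i j, |G i j - √N / β N * x i j| < √N / β N * δ}
    {M | ∀ i j, |β N * M i j - x i j| < r} ?_ ?_
  · have h4 : (μ N).real {A | (fun i j => corner hk A i j) ∈
        {M : Fin k → Fin k → ℝ | ∀ i j, |β N * M i j - x i j| < r}} =
        (μ N).real {A | ∀ i j, |β N * corner hk A i j - x i j| < r} := rfl
    rw [h4] at h3
    linarith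
  · simp only [Set.ofPred_forall]
    exact MeasurableSet.iInter fun i => MeasurableSet.iInter fun j =>
      measurableSet_lt (by fun_prop) measurable_const
  · intro M T hT hMT i j
    have h4 : ∀ i j, |(β N • (M * T)) i j - x i j| < δ := fun i j => by
      have h5 : √N * (M * T) i j - √N / β N * x i j =
          √N / β N * ((β N • (M * T)) i j - x i j) := by
        rw [Matrix.smul_apply, smul_eq_mul]
        field_simp
      have h6 := hMT i j
      rw [h5, abs_mul, abs_of_pos (div_pos hN' hβ)] at h6
      exact lt_of_mul_lt_mul_left h6 (div_pos hN' hβ).le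
    have h5 : ‖β N • (M * T)‖ ≤ √(2 * b) := by
      refine Real.le_sqrt_of_sq_le ?_
      rw [frobenius_norm_sq, hb, Finset.mul_sum]
      refine Finset.sum_le_sum fun i _ => ?_
      rw [Finset.mul_sum]
      refine Finset.sum_le_sum fun j _ => ?_
      rw [mul_div_cancel₀ _ two_ne_zero, sq_le_sq, abs_of_nonneg (a := |x i j| + δ) (by positivity)]
      have := abs_sub_abs_le_abs_sub ((β N • (M * T)) i j) (x i j)
      linarith [h4 i j]
    have h6 : β N • (M * T) - β N • M = (β N • M) * (T - 1) := by
      rw [mul_sub, mul_one, Matrix.smul_mul]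
    have h7 : ‖β N • (M * T) - β N • M‖ ≤ ‖β N • M‖ * ε := by
      rw [h6]
      exact (norm_mul_le _ _).trans (mul_le_mul_of_nonneg_left hT (norm_nonneg _))
    have h8 : ‖β N • M‖ ≤ 2 * √(2 * b) := by
      have h9 := norm_sub_norm_le (β N • M) (β N • (M * T))
      rw [norm_sub_rev] at h9
      nlinarith [norm_nonneg (β N • M)]
    have h9 : |(β N • (M * T)) i j - β N * M i j| ≤ r / 2 := by
      refine (abs_apply_le_frobenius_norm (β N • (M * T) - β N • M) i j).trans (h7.trans ?_)
      refine le_trans ?_ hεr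
      rw [mul_comm]
      gcongr
    rw [abs_sub_comm] at h9
    have := abs_sub_le (β N * M i j) ((β N • (M * T)) i j) (x i j)
    linarith [h4 i j]

end Moderate

lemma rateJ_eq_coe {x : ℕ → ℕ → ℝ} (hx : Summable fun p : ℕ × ℕ => x p.1 p.2 ^ 2) :
    rateJ x = ((1 / 2 * ∑' p : ℕ × ℕ, x p.1 p.2 ^ 2 : ℝ) : EReal) := if_pos hx

lemma rateJ_le_of_sum_le {x : ℕ → ℕ → ℝ} {m : ℝ}
    (h : ∀ k : ℕ, ∑ p ∈ Finset.range k ×ˢ Finset.range k, x p.1 p.2 ^ 2 ≤ 2 * m) :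
    rateJ x ≤ m := by
  have h1 : ∀ F : Finset (ℕ × ℕ), ∑ p ∈ F, x p.1 p.2 ^ 2 ≤ 2 * m := fun F => by
    obtain ⟨k, hk⟩ : ∃ k, F ⊆ Finset.range k ×ˢ Finset.range k := by
      refine ⟨(F.sup fun p => p.1 + p.2) + 1, fun p hp => ?_⟩
      have := Finset.le_sup (f := fun p : ℕ × ℕ => p.1 + p.2) hp
      simp only [Finset.mem_product, Finset.mem_range]
      omega
    exact (Finset.sum_le_sum_of_subset_of_nonneg hk fun _ _ _ => sq_nonneg _).trans (h k)
  have h0 : 0 ≤ fun p : ℕ × ℕ => x p.1 p.2 ^ 2 := fun p => sq_nonneg _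
  rw [rateJ_eq_coe (summable_of_sum_le h0 h1), EReal.coe_le_coe_iff]
  linarith [Real.tsum_le_of_sum_le h0 h1]

lemma exists_forall_lt_sum_sq {C : Set (ℕ → ℕ → ℝ)} (hC : IsClosed C) {m : ℝ}
    (hm : ∀ x ∈ C, (m : EReal) < rateJ x) :
    ∃ k : ℕ, ∀ x ∈ C, 2 * m < ∑ p ∈ Finset.range k ×ˢ Finset.range k, x p.1 p.2 ^ 2 := by
  by_contra! hcon
  choose x hxC hxm using hcon
  set y : ℕ → ℕ → ℕ → ℝ := fun k i j => if i < k ∧ j < k then x k i j else 0 with hy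
  have hbound : ∀ k i j, y k i j ∈ Set.Icc (-√(2 * m)) √(2 * m) := fun k i j => by
    rw [Set.mem_Icc, ← abs_le]
    simp only [hy]
    split_ifs with h
    · refine Real.abs_le_sqrt (le_trans ?_ (hxm k))
      exact Finset.single_le_sum (f := fun p : ℕ × ℕ => x k p.1 p.2 ^ 2)
        (fun _ _ => sq_nonneg _) (a := (i, j)) (by simpa using h)
    · simp
  have hK : IsCompact (Set.univ.pi fun _ : ℕ => Set.univ.pi fun _ : ℕ =>
      Set.Icc (-√(2 * m)) √(2 * m)) :=
    isCompact_univ_pi fun _ => isCompact_univ_pi fun _ => isCompact_Icc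
  obtain ⟨z, -, φ, hφ, hz⟩ := hK.tendsto_subseq (x := y) fun k => by
    simpa only [Set.mem_univ_pi] using hbound k
  have hxz : ∀ i j, Tendsto (fun n => x (φ n) i j) atTop (nhds (z i j)) := fun i j => by
    have h1 := tendsto_pi_nhds.1 (tendsto_pi_nhds.1 hz i) j
    refine h1.congr' ?_
    filter_upwards [hφ.tendsto_atTop.eventually_gt_atTop i,
      hφ.tendsto_atTop.eventually_gt_atTop j] with n hi hj
    exact if_pos ⟨hi, hj⟩
  have hzC : z ∈ C := hC.mem_of_tendsto
    (tendsto_pi_nhds.2 fun i => tendsto_pi_nhds.2 (hxz i)) (Eventually.of_forall fun n => hxC (φ n))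
  refine (hm z hzC).not_ge (rateJ_le_of_sum_le fun k => ?_)
  refine le_of_tendsto (tendsto_finsetSum _ fun p _ => (hxz p.1 p.2).pow 2) ?_
  filter_upwards [hφ.tendsto_atTop.eventually_ge_atTop k] with n hn
  refine (Finset.sum_le_sum_of_subset_of_nonneg ?_ fun _ _ _ => sq_nonneg _).trans (hxm (φ n))
  exact Finset.product_subset_product (Finset.range_subset_range.2 hn)
    (Finset.range_subset_range.2 hn)

lemma exists_box_subset_of_isOpen {O : Set (ℕ → ℕ → ℝ)} (hO : IsOpen O) {x : ℕ → ℕ → ℝ}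
    (hx : x ∈ O) :
    ∃ (k : ℕ) (r : ℝ), 0 < r ∧ ∀ y : ℕ → ℕ → ℝ, (∀ i < k, ∀ j < k, |y i j - x i j| < r) →
      y ∈ O := by
  by_contra! hcon
  choose y hy hyO using fun k : ℕ => hcon k (1 / ((k : ℝ) + 1)) (by positivity)
  have hyx : Tendsto y atTop (nhds x) := by
    refine tendsto_pi_nhds.2 fun i => tendsto_pi_nhds.2 fun j => ?_
    rw [tendsto_iff_dist_tendsto_zero]
    refine squeeze_zero' (Eventually.of_forall fun _ => dist_nonneg) ?_
      tendsto_one_div_add_atTop_nhds_zero_nat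
    filter_upwards [eventually_gt_atTop i, eventually_gt_atTop j] with k hi hj
    exact (hy k i hi j hj).le
  obtain ⟨k, hk⟩ := (hyx.eventually (hO.mem_nhds hx)).exists
  exact hyO k hk

lemma neg_le_mul_log_of_exp_le {v a : ℝ} (hv : 0 < v) {P : ENNReal} (hP : P ≠ ⊤)
    (h : Real.exp (-v * a) ≤ P.toReal) :
    (-a : EReal) ≤ ((v⁻¹ : ℝ) : EReal) * ENNReal.log P := by
  have h1 := ENNReal.log_le_log ((ENNReal.ofReal_le_iff_le_toReal hP).2 h)
  rw [ENNReal.log_ofReal_of_pos (Real.exp_pos _), Real.log_exp] at h1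
  refine le_trans (le_of_eq ?_) (mul_le_mul_of_nonneg_left h1
    (EReal.coe_nonneg.2 (inv_nonneg.2 hv.le)))
  rw [← EReal.coe_mul, ← EReal.coe_neg, EReal.coe_eq_coe_iff]
  field_simp

lemma mul_log_le_neg_of_le_exp {v a : ℝ} (hv : 0 < v) {P : ENNReal} (hP : P ≠ ⊤)
    (h : P.toReal ≤ Real.exp (-v * a)) :
    ((v⁻¹ : ℝ) : EReal) * ENNReal.log P ≤ (-a : EReal) := by
  have h1 := ENNReal.log_le_log ((ENNReal.le_ofReal_iff_toReal_le hP (Real.exp_pos _).le).2 h)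
  rw [ENNReal.log_ofReal_of_pos (Real.exp_pos _), Real.log_exp] at h1
  refine (mul_le_mul_of_nonneg_left h1 (EReal.coe_nonneg.2 (inv_nonneg.2 hv.le))).trans
    (le_of_eq ?_)
  rw [← EReal.coe_mul, ← EReal.coe_neg, EReal.coe_eq_coe_iff]
  field_simp

lemma matEmb_eq_corner {k N : ℕ} (hk : k ≤ N) (A : Matrix (Fin N) (Fin N) ℝ) {i j : ℕ}
    (hi : i < k) (hj : j < k) : matEmb A i j = corner hk A ⟨i, hi⟩ ⟨j, hj⟩ :=
  dif_pos ⟨hi.trans_le hk, hj.trans_le hk⟩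

end OrthogonalModerateDeviations

/-- **Moderate deviation principle for the orthogonal group.** Here `μ N` is the Haar
probability measure on `O(N)` (a probability measure on `N × N` matrices, concentrated on
orthogonal matrices and invariant under left multiplication by orthogonal matrices). The
sequence `β_N · A_N`, embedded into `ℝ^{ℕ × ℕ}` (product topology), satisfies an LDP
with speed `N/β_N²` and rate function `J`. -/
theorem stmt_9
    (μ : (N : ℕ) → Measure (Matrix (Fin N) (Fin N) ℝ))
    (hμ_prob : ∀ N, IsProbabilityMeasure (μ N))
    (hμ_supp : ∀ N, μ N {A | A * Aᵀ = 1} = 1)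
    (hμ_inv : ∀ N (B : Matrix (Fin N) (Fin N) ℝ), B * Bᵀ = 1 →
      (μ N).map (fun A => B * A) = μ N)
    (β : ℕ → ℝ) (hβ_pos : ∀ N, 0 < β N)
    (hβ_top : Tendsto β atTop atTop)
    (hβ_o : β =o[atTop] fun N => Real.sqrt N) :
    (∀ O : Set (ℕ → ℕ → ℝ), IsOpen O →
      - ⨅ A ∈ O, rateJ A ≤
        Filter.liminf (fun N => ((β N ^ 2 / N : ℝ) : EReal) *
          ENNReal.log (μ N {M | (fun i j => β N * matEmb M i j) ∈ O})) atTop) ∧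
    (∀ C : Set (ℕ → ℕ → ℝ), IsClosed C →
      Filter.limsup (fun N => ((β N ^ 2 / N : ℝ) : EReal) *
          ENNReal.log (μ N {M | (fun i j => β N * matEmb M i j) ∈ C})) atTop ≤
        - ⨅ A ∈ C, rateJ A) := by
  have hμ : ∀ N, IsOrthogonalHaar (μ N) := fun N => ⟨hμ_prob N, hμ_supp N, hμ_inv N⟩
  have hβN : ∀ N : ℕ, β N ^ 2 / N = ((N : ℝ) / β N ^ 2)⁻¹ := fun N => (inv_div _ _).symm
  have hpos : ∀ᶠ N : ℕ in atTop, 0 < (N : ℝ) / β N ^ 2 :=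
    (tendsto_natCast_div_sq_atTop hβ_pos hβ_o).eventually_gt_atTop 0
  simp only [hβN]
  refine ⟨fun O hO => ?_, fun C hC => ?_⟩
  · rw [EReal.neg_le]
    refine le_iInf₂ fun x hx => ?_
    by_cases hs : Summable fun p : ℕ × ℕ => x p.1 p.2 ^ 2
    swap
    · rw [show rateJ x = ⊤ from if_neg hs]
      exact le_top
    refine EReal.le_of_forall_lt_iff_le.1 fun a ha => ?_
    rw [EReal.neg_le]
    obtain ⟨k, r, hr, hbox⟩ := exists_box_subset_of_isOpen hO hx
    have hxa : ∑ i : Fin k, ∑ j : Fin k, x i j ^ 2 / 2 < a := by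
      rw [rateJ_eq_coe hs, EReal.coe_lt_coe_iff] at ha
      refine lt_of_le_of_lt ?_ ha
      have h1 := hs.sum_le_tsum (Finset.range k ×ˢ Finset.range k) fun _ _ => sq_nonneg _
      rw [Finset.sum_product, Finset.sum_range] at h1
      simp only [Finset.sum_range] at h1
      simp only [← Finset.sum_div]
      linarith
    refine le_liminf_of_le (by isBoundedDefault) ?_
    filter_upwards [hpos, eventually_ge_atTop k, eventually_exp_le_measure_box hμ hβ_pos hβ_top
      hβ_o (fun i j : Fin k => x i j) hr hxa] with N hN hk hle
    refine neg_le_mul_log_of_exp_le hN (measure_ne_top _ _) ((hle hk).trans ?_)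
    refine measureReal_mono fun A hA => hbox _ fun i hi j hj => ?_
    rw [matEmb_eq_corner hk A hi hj]
    exact hA ⟨i, hi⟩ ⟨j, hj⟩
  · rw [EReal.le_neg]
    refine EReal.ge_of_forall_gt_iff_ge.1 fun a ha => ?_
    rw [EReal.le_neg]
    obtain ⟨m, ham, hmI⟩ := EReal.lt_iff_exists_real_btwn.1 ha
    rw [EReal.coe_lt_coe_iff] at ham
    refine limsup_le_of_le (by isBoundedDefault) ?_
    rcases le_or_gt m 0 with hm | hm
    · filter_upwards [hpos] with N hN
      refine mul_log_le_neg_of_le_exp hN (measure_ne_top _ _) (measureReal_le_one.trans ?_)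
      exact Real.one_le_exp (by nlinarith)
    · obtain ⟨k, hk⟩ := exists_forall_lt_sum_sq hC fun x hx => hmI.trans_le (iInf₂_le x hx)
      filter_upwards [hpos, eventually_ge_atTop k,
        eventually_measure_sum_sq_ge_le hμ hβ_pos hβ_top hβ_o k ham] with N hN hkN hle
      refine mul_log_le_neg_of_le_exp hN (measure_ne_top _ _) (le_trans ?_ (hle hkN))
      refine measureReal_mono fun A hA => (hk _ hA).le.trans_eq ?_
      rw [Finset.sum_product, Finset.sum_range]
      refine Finset.sum_congr rfl fun i _ => ?_
      rw [Finset.sum_range]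
      refine Finset.sum_congr rfl fun j _ => ?_
      rw [matEmb_eq_corner hkN A i.2 j.2]
end

section
/- Fix m, k ∈ ℕ and for each N ≥ m+k let Z_N be the m×k upper-left block of a Haar-distributed matrix in O(N). Let β_N be a sequence of positive reals with β_N → ∞ and β_N = o(√N). Then for every A ∈ ℝ^{m×k}, lim_{r→0} limsup_{N→∞} (β_N²/N)·log ℙ(β_N·Z_N ∈ B_r(A)) ≤ −(1/2)·‖A‖_F², where B_r(A) is the open Euclidean (Frobenius-norm) ball of radius r around A in ℝ^{m×k}. -/
open MeasureTheory Filter Matrix Asymptotics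

/-- Squared Frobenius norm of a matrix. -/
def frobSq {m k : ℕ} (B : Matrix (Fin m) (Fin k) ℝ) : ℝ :=
  ∑ i, ∑ j, (B i j) ^ 2

/-- Frobenius norm of a matrix. -/
noncomputable def frobNorm {m k : ℕ} (B : Matrix (Fin m) (Fin k) ℝ) : ℝ :=
  Real.sqrt (frobSq B)

/-- The upper-left `m × k` block of an `N × N` matrix (padded with zeros if needed). -/
def blockEmb (m k : ℕ) {N : ℕ} (A : Matrix (Fin N) (Fin N) ℝ) :
    Matrix (Fin m) (Fin k) ℝ :=
  Matrix.of fun i j => if h : (i : ℕ) < N ∧ (j : ℕ) < N then A ⟨i, h.1⟩ ⟨j, h.2⟩ else 0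

open scoped MatrixOrder in
/-- The square root of a positive semidefinite matrix is at least as close to the identity as the
matrix itself. -/
lemma exists_sqrt_near_one_s10 {n : Type*} [Fintype n] [DecidableEq n] {P : Matrix n n ℝ}
    (hP : P.PosSemidef) : ∃ S : Matrix n n ℝ, S.PosSemidef ∧ S * S = P ∧
      ∀ i j, (S i j - (1 : Matrix n n ℝ) i j) ^ 2 ≤
        ∑ a, ∑ b, (P a b - (1 : Matrix n n ℝ) a b) ^ 2 := by
  have hS : (CFC.sqrt P).PosSemidef := Matrix.nonneg_iff_posSemidef.mp (CFC.sqrt_nonneg P)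
  have hSS : CFC.sqrt P * CFC.sqrt P = P := CFC.sqrt_mul_sqrt_self P hP.nonneg
  refine ⟨CFC.sqrt P, hS, hSS, fun i j => ?_⟩
  set S := CFC.sqrt P
  have hSt : Sᵀ = S := by simpa using hS.isHermitian.eq
  have htrace (X : Matrix n n ℝ) : (Xᵀ * X).trace = ∑ a, ∑ b, X a b ^ 2 := by
    simp only [Matrix.trace, Matrix.diag, Matrix.mul_apply, Matrix.transpose_apply]
    rw [Finset.sum_comm]
    simp only [sq]
  have h1 : 0 ≤ ((S - 1)ᵀ * (S + S + Sᵀ * S) * (S - 1)).trace := by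
    have hpos : (S + S + Sᵀ * S).PosSemidef := by
      refine (hS.add hS).add ?_
      simpa using Matrix.posSemidef_conjTranspose_mul_self S
    have h := (hpos.conjTranspose_mul_mul_same (S - 1)).trace_nonneg
    rwa [Matrix.conjTranspose_eq_transpose_of_trivial] at h
  have h2 : (P - 1)ᵀ * (P - 1) = (S - 1)ᵀ * (S - 1) + (S - 1)ᵀ * (S + S + Sᵀ * S) * (S - 1) := by
    rw [← hSS]
    simp only [Matrix.transpose_sub, Matrix.transpose_mul, hSt, Matrix.transpose_one]
    noncomm_ring
  have h3 : ∑ a, ∑ b, (S - 1) a b ^ 2 ≤ ∑ a, ∑ b, (P - 1) a b ^ 2 := by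
    have h4 := congrArg Matrix.trace h2
    rw [Matrix.trace_add, htrace, htrace] at h4
    rw [h4]
    exact le_add_of_nonneg_right h1
  refine le_trans ?_ h3
  calc (S - 1) i j ^ 2 ≤ ∑ b, (S - 1) i b ^ 2 :=
        Finset.single_le_sum (f := fun b => (S - 1) i b ^ 2) (fun _ _ => sq_nonneg _)
          (Finset.mem_univ j)
    _ ≤ _ := Finset.single_le_sum (f := fun a => ∑ b, (S - 1) a b ^ 2)
        (fun _ _ => Finset.sum_nonneg fun _ _ => sq_nonneg _) (Finset.mem_univ i)

/-- Polar decomposition of a matrix with nearly orthonormal rows. -/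
lemma exists_polar_of_near_orthonormal (m : ℕ) {ε : ℝ} (hε : 0 < ε) :
    ∃ δ > 0, ∀ (N : ℕ) (H : Matrix (Fin m) (Fin N) ℝ),
      (∀ i j, |(H * Hᵀ) i j - (1 : Matrix (Fin m) (Fin m) ℝ) i j| ≤ δ) →
      ∃ (S : Matrix (Fin m) (Fin m) ℝ) (Q : Matrix (Fin m) (Fin N) ℝ),
        H = S * Q ∧ Q * Qᵀ = 1 ∧
        ∀ i j, |S i j - (1 : Matrix (Fin m) (Fin m) ℝ) i j| ≤ ε := by
  have hdet : ∀ᶠ P : Fin m → Fin m → ℝ in nhds (1 : Matrix (Fin m) (Fin m) ℝ),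
      Matrix.det (Matrix.of P) ≠ 0 := by
    have hc : Continuous fun P : Matrix (Fin m) (Fin m) ℝ => P.det :=
      continuous_id.matrix_det
    refine (hc.tendsto 1).eventually_ne ?_
    simp
  obtain ⟨δ₀, hδ₀, hball⟩ := Metric.eventually_nhds_iff.mp hdet
  refine ⟨min (δ₀ / 2) (ε / (m + 1)), by positivity, fun N H hH => ?_⟩
  have hP : (H * Hᵀ).PosSemidef := by
    simpa using Matrix.posSemidef_self_mul_conjTranspose H
  obtain ⟨S, hS, hSS, hnear⟩ := exists_sqrt_near_one_s10 hP
  have hPdet : (H * Hᵀ).det ≠ 0 := by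
    refine hball (y := H * Hᵀ) (lt_of_le_of_lt ?_ (half_lt_self hδ₀))
    refine (dist_pi_le_iff (by positivity)).2 fun i => (dist_pi_le_iff (by positivity)).2 fun j => ?_
    rw [Real.dist_eq]
    exact (hH i j).trans (min_le_left _ _)
  have hSdet : IsUnit S.det := by
    rw [isUnit_iff_ne_zero]
    intro h
    rw [← hSS, Matrix.det_mul, h, zero_mul] at hPdet
    exact hPdet rfl
  have hSt : Sᵀ = S := by simpa using hS.isHermitian.eq
  refine ⟨S, S⁻¹ * H, ?_, ?_, fun i j => ?_⟩
  · rw [← Matrix.mul_assoc, Matrix.mul_nonsing_inv _ hSdet, Matrix.one_mul]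
  · rw [Matrix.transpose_mul, Matrix.transpose_nonsing_inv, hSt, Matrix.mul_assoc,
      ← Matrix.mul_assoc H, ← hSS, Matrix.mul_assoc S, Matrix.mul_nonsing_inv _ hSdet,
      Matrix.mul_one, Matrix.nonsing_inv_mul _ hSdet]
  · refine abs_le_of_sq_le_sq ?_ hε.le
    refine (hnear i j).trans ?_
    have hb : ∀ a b, ((H * Hᵀ) a b - (1 : Matrix (Fin m) (Fin m) ℝ) a b) ^ 2
        ≤ (ε / (m + 1)) ^ 2 := fun a b => by
      rw [← sq_abs]
      exact pow_le_pow_left₀ (abs_nonneg _) ((hH a b).trans (min_le_right _ _)) 2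
    calc _ ≤ ∑ a : Fin m, ∑ b : Fin m, (ε / (m + 1)) ^ 2 :=
          Finset.sum_le_sum fun a _ => Finset.sum_le_sum fun b _ => hb a b
      _ = (m * (ε / (m + 1))) ^ 2 := by
          simp only [Finset.sum_const, Finset.card_univ, Fintype.card_fin, nsmul_eq_mul]; ring
      _ ≤ ε ^ 2 := by
          refine pow_le_pow_left₀ (by positivity) ?_ 2
          rw [mul_div_assoc', div_le_iff₀ (by positivity)]
          nlinarith

/-- A matrix with orthonormal rows extends to a square orthogonal matrix. -/
lemma exists_orthogonal_extension_s10 {m N : ℕ} (hmN : m ≤ N) {Q : Matrix (Fin m) (Fin N) ℝ}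
    (hQ : Q * Qᵀ = 1) : ∃ O : Matrix (Fin N) (Fin N) ℝ, O * Oᵀ = 1 ∧
      ∀ i, O (Fin.castLE hmN i) = Q i := by
  let v : Fin N → EuclideanSpace ℝ (Fin N) := fun a =>
    if h : (a : ℕ) < m then WithLp.toLp 2 (Q ⟨a, h⟩) else 0
  have hinner (x y : EuclideanSpace ℝ (Fin N)) : inner ℝ x y = ∑ n, x n * y n := by
    simp [PiLp.inner_apply, mul_comm]
  have hv : Orthonormal ℝ (({a : Fin N | (a : ℕ) < m} : Set (Fin N)).domRestrict v) := by
    rw [orthonormal_iff_ite]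
    rintro ⟨a, ha⟩ ⟨b, hb⟩
    have ha' : (a : ℕ) < m := ha
    have hb' : (b : ℕ) < m := hb
    have h := congrFun (congrFun hQ ⟨a, ha'⟩) ⟨b, hb'⟩
    simp only [Matrix.mul_apply, Matrix.transpose_apply, Matrix.one_apply] at h
    rw [hinner]
    simpa [v, ha', hb', Fin.ext_iff] using h
  obtain ⟨b, hb⟩ := hv.exists_orthonormalBasis_extension_of_card_eq (by simp)
  refine ⟨Matrix.of fun a n => b a n, ?_, fun i => ?_⟩
  · ext a c
    have h := orthonormal_iff_ite.mp b.orthonormal a c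
    rw [hinner] at h
    simpa [Matrix.mul_apply, Matrix.one_apply] using h
  · have h := hb (Fin.castLE hmN i) (by simp)
    ext n
    simp [h, v]

/-- Random signs are subgaussian. -/
lemma sum_exp_signs_le {ι : Type*} [Fintype ι] [DecidableEq ι] (x : ι → ℝ) :
    ∑ g : ι → ℤˣ, Real.exp (∑ i, ((g i : ℤ) : ℝ) * x i) ≤
      Fintype.card (ι → ℤˣ) * Real.exp (1 / 2 * ∑ i, x i ^ 2) := by
  simp_rw [Real.exp_sum]
  rw [← Fintype.prod_sum (fun i (u : ℤˣ) => Real.exp (((u : ℤ) : ℝ) * x i)), Finset.mul_sum,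
    Real.exp_sum, Fintype.card_fun, Fintype.card_units_int]
  push_cast
  rw [← Finset.card_univ, ← Finset.prod_const, ← Finset.prod_mul_distrib]
  refine Finset.prod_le_prod (fun i _ => by positivity) fun i _ => ?_
  have h := Real.cosh_le_exp_half_sq (x i)
  rw [Real.cosh_eq] at h
  have h2 : ∑ u : ℤˣ, Real.exp (((u : ℤ) : ℝ) * x i) = Real.exp (x i) + Real.exp (-x i) := by
    have : (Finset.univ : Finset ℤˣ) = {1, -1} := rfl
    rw [this, Finset.sum_pair (by decide)]
    simp
  rw [h2, one_div_mul_eq_div]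
  linarith

lemma sum_sq_sum_signs {m N : ℕ} {i j : Fin m} (hij : i ≠ j) :
    ∑ g : Fin m × Fin N → ℤˣ, (∑ n, ((g (i, n) : ℤ) : ℝ) * ((g (j, n) : ℤ) : ℝ)) ^ 2 =
      N * Fintype.card (Fin m × Fin N → ℤˣ) := by
  have hexp (g : Fin m × Fin N → ℤˣ) :
      (∑ n, ((g (i, n) : ℤ) : ℝ) * ((g (j, n) : ℤ) : ℝ)) ^ 2 =
        ∑ n, ∑ l, (((g (i, n) : ℤ) : ℝ) * ((g (j, n) : ℤ) : ℝ)) *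
          (((g (i, l) : ℤ) : ℝ) * ((g (j, l) : ℤ) : ℝ)) := by
    rw [sq, Finset.sum_mul_sum]
  have hterm (n l : Fin N) :
      ∑ g : Fin m × Fin N → ℤˣ, (((g (i, n) : ℤ) : ℝ) * ((g (j, n) : ℤ) : ℝ)) *
          (((g (i, l) : ℤ) : ℝ) * ((g (j, l) : ℤ) : ℝ)) =
        if n = l then (Fintype.card (Fin m × Fin N → ℤˣ) : ℝ) else 0 := by
    split_ifs with hnl
    · subst hnl
      have hsq (u : ℤˣ) : ((u : ℤ) : ℝ) * ((u : ℤ) : ℝ) = 1 := by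
        rcases Int.units_eq_one_or u with rfl | rfl <;> simp
      have (g : Fin m × Fin N → ℤˣ) : (((g (i, n) : ℤ) : ℝ) * ((g (j, n) : ℤ) : ℝ)) *
          (((g (i, n) : ℤ) : ℝ) * ((g (j, n) : ℤ) : ℝ)) = 1 := by
        rw [mul_mul_mul_comm, hsq, hsq, one_mul]
      simp only [this, Finset.sum_const, Finset.card_univ, nsmul_eq_mul, mul_one]
    · have h := Equiv.sum_comp (Equiv.mulRight (Pi.mulSingle (i, n) (-1 : ℤˣ)))
        (fun g : Fin m × Fin N → ℤˣ => (((g (i, n) : ℤ) : ℝ) * ((g (j, n) : ℤ) : ℝ)) *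
          (((g (i, l) : ℤ) : ℝ) * ((g (j, l) : ℤ) : ℝ)))
      simp only [Equiv.coe_mulRight, Pi.mul_apply, Pi.mulSingle_apply, Prod.mk.injEq, true_and,
        if_true, hij.symm, false_and, if_false, Ne.symm hnl, mul_one, Units.val_neg,
        Int.cast_neg, mul_neg, neg_mul,
        Finset.sum_neg_distrib] at h
      linarith
  simp_rw [hexp]
  rw [Finset.sum_comm]
  simp_rw [Finset.sum_comm (s := (Finset.univ : Finset (Fin m × Fin N → ℤˣ))), hterm]
  simp

/-- The `m × N` matrix with entries `± 1 / √N` given by a family of signs. -/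
noncomputable def signMatrix {m N : ℕ} (g : Fin m × Fin N → ℤˣ) : Matrix (Fin m) (Fin N) ℝ :=
  Matrix.of fun i n => (Real.sqrt N)⁻¹ * ((g (i, n) : ℤ) : ℝ)

lemma signMatrix_mul_transpose_apply {m N : ℕ} (g : Fin m × Fin N → ℤˣ) (i j : Fin m) :
    (signMatrix g * (signMatrix g)ᵀ) i j =
      (N : ℝ)⁻¹ * ∑ n, ((g (i, n) : ℤ) : ℝ) * ((g (j, n) : ℤ) : ℝ) := by
  simp only [signMatrix, Matrix.mul_apply, Matrix.transpose_apply, Matrix.of_apply]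
  rw [Finset.mul_sum]
  refine Finset.sum_congr rfl fun n _ => ?_
  rw [mul_mul_mul_comm, ← mul_inv, Real.mul_self_sqrt (Nat.cast_nonneg N)]

/-- The sign families whose sign matrix has rows that are orthonormal up to `δ`. -/
noncomputable def nearOrthonormalSigns (m N : ℕ) (δ : ℝ) : Finset (Fin m × Fin N → ℤˣ) :=
  open Classical in
  Finset.univ.filter fun g => ∀ i j,
    |(signMatrix g * (signMatrix g)ᵀ) i j - (1 : Matrix (Fin m) (Fin m) ℝ) i j| ≤ δ

lemma sum_sq_gram_signMatrix_sub_one_le {m N : ℕ} (hN : 0 < N) (i j : Fin m) :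
    ∑ g : Fin m × Fin N → ℤˣ,
      ((signMatrix g * (signMatrix g)ᵀ) i j - (1 : Matrix (Fin m) (Fin m) ℝ) i j) ^ 2 ≤
        (N : ℝ)⁻¹ * Fintype.card (Fin m × Fin N → ℤˣ) := by
  have hN' : (N : ℝ) ≠ 0 := by positivity
  simp_rw [signMatrix_mul_transpose_apply]
  rcases eq_or_ne i j with rfl | hij
  · have hsq (u : ℤˣ) : ((u : ℤ) : ℝ) * ((u : ℤ) : ℝ) = 1 := by
      rcases Int.units_eq_one_or u with rfl | rfl <;> simp
    simp only [hsq, Finset.sum_const, Finset.card_univ, Fintype.card_fin, nsmul_eq_mul, mul_one,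
      Matrix.one_apply_eq, inv_mul_cancel₀ hN', sub_self]
    rw [zero_pow two_ne_zero, mul_zero]
    positivity
  · simp_rw [Matrix.one_apply_ne hij, sub_zero, mul_pow]
    rw [← Finset.mul_sum, sum_sq_sum_signs hij]
    refine le_of_eq ?_
    field_simp

/-- For large `N`, at least half of all sign families are nearly orthonormal. -/
lemma card_le_two_mul_card_nearOrthonormalSigns (m : ℕ) {δ : ℝ} (hδ : 0 < δ) :
    ∀ᶠ N : ℕ in atTop, (Fintype.card (Fin m × Fin N → ℤˣ) : ℝ) ≤
      2 * (nearOrthonormalSigns m N δ).card := by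
  classical
  have hlarge := (tendsto_natCast_atTop_atTop (R := ℝ)).eventually_ge_atTop
    (2 * m ^ 2 / δ ^ 2)
  filter_upwards [hlarge, eventually_gt_atTop 0] with N hN hN0
  set T : ℝ := ((Fintype.card (Fin m × Fin N → ℤˣ) : ℕ) : ℝ) with hT
  have hT0 : 0 ≤ T := by positivity
  have hNpos : (0 : ℝ) < N := by exact_mod_cast hN0
  let f : (Fin m × Fin N → ℤˣ) → ℝ := fun g => ∑ i, ∑ j,
    ((signMatrix g * (signMatrix g)ᵀ) i j - (1 : Matrix (Fin m) (Fin m) ℝ) i j) ^ 2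
  have hf0 (g) : 0 ≤ f g := Finset.sum_nonneg fun _ _ => Finset.sum_nonneg fun _ _ => sq_nonneg _
  have hsum : ∑ g, f g ≤ m ^ 2 * ((N : ℝ)⁻¹ * T) := by
    calc ∑ g, f g = ∑ i, ∑ j, ∑ g : Fin m × Fin N → ℤˣ,
          ((signMatrix g * (signMatrix g)ᵀ) i j - (1 : Matrix (Fin m) (Fin m) ℝ) i j) ^ 2 := by
          rw [Finset.sum_comm]
          exact Finset.sum_congr rfl fun i _ => Finset.sum_comm
      _ ≤ ∑ i : Fin m, ∑ j : Fin m, (N : ℝ)⁻¹ * T := Finset.sum_le_sum fun i _ =>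
          Finset.sum_le_sum fun j _ => sum_sq_gram_signMatrix_sub_one_le hN0 i j
      _ = _ := by
          simp only [Finset.sum_const, Finset.card_univ, Fintype.card_fin, nsmul_eq_mul]; ring
  have hbad : ((nearOrthonormalSigns m N δ)ᶜ.card : ℝ) * δ ^ 2 ≤ ∑ g, f g := by
    rw [← nsmul_eq_mul]
    refine (Finset.card_nsmul_le_sum _ f _ fun g hg => ?_).trans
      (Finset.sum_le_univ_sum_of_nonneg hf0)
    simp only [nearOrthonormalSigns, Finset.mem_compl, Finset.mem_filter, Finset.mem_univ,
      true_and, not_forall, not_le] at hg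
    obtain ⟨i, j, hij⟩ := hg
    calc δ ^ 2 ≤ ((signMatrix g * (signMatrix g)ᵀ) i j
          - (1 : Matrix (Fin m) (Fin m) ℝ) i j) ^ 2 := by
          rw [← sq_abs (_ - _)]
          exact pow_le_pow_left₀ hδ.le hij.le 2
      _ ≤ ∑ j', ((signMatrix g * (signMatrix g)ᵀ) i j'
          - (1 : Matrix (Fin m) (Fin m) ℝ) i j') ^ 2 :=
          Finset.single_le_sum (f := fun j' => ((signMatrix g * (signMatrix g)ᵀ) i j'
            - (1 : Matrix (Fin m) (Fin m) ℝ) i j') ^ 2)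
            (fun _ _ => sq_nonneg _) (Finset.mem_univ j)
      _ ≤ f g := Finset.single_le_sum (f := fun i' => ∑ j', ((signMatrix g * (signMatrix g)ᵀ) i' j'
          - (1 : Matrix (Fin m) (Fin m) ℝ) i' j') ^ 2)
          (fun _ _ => Finset.sum_nonneg fun _ _ => sq_nonneg _) (Finset.mem_univ i)
  have hcompl : ((nearOrthonormalSigns m N δ).card : ℝ)
      + ((nearOrthonormalSigns m N δ)ᶜ.card : ℝ) = T := by
    rw [hT]
    exact_mod_cast Finset.card_add_card_compl _
  have hsmall : m ^ 2 * ((N : ℝ)⁻¹ * T) ≤ T / 2 * δ ^ 2 := by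
    rw [div_le_iff₀ (by positivity)] at hN
    have : (m : ℝ) ^ 2 * (N : ℝ)⁻¹ ≤ δ ^ 2 / 2 := by
      rw [← div_eq_mul_inv, div_le_iff₀ hNpos]
      linarith
    nlinarith
  have hle : ((nearOrthonormalSigns m N δ)ᶜ.card : ℝ) ≤ T / 2 :=
    le_of_mul_le_mul_right (hbad.trans (hsum.trans hsmall)) (by positivity)
  linarith

/-- The entrywise inner product of two matrices. -/
def frobInner {m k : ℕ} (A B : Matrix (Fin m) (Fin k) ℝ) : ℝ :=
  ∑ i, ∑ j, A i j * B i j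

lemma frobInner_smul {m k : ℕ} (A B : Matrix (Fin m) (Fin k) ℝ) (c : ℝ) :
    frobInner A (c • B) = c * frobInner A B := by
  simp only [frobInner, Matrix.smul_apply, smul_eq_mul, Finset.mul_sum]
  exact Finset.sum_congr rfl fun _ _ => Finset.sum_congr rfl fun _ _ => by ring

/-- The first `k` columns of an `N × N` matrix. -/
def firstCols {k N : ℕ} (hkN : k ≤ N) (M : Matrix (Fin N) (Fin N) ℝ) :
    Matrix (Fin N) (Fin k) ℝ :=
  M.submatrix id (Fin.castLE hkN)

lemma firstCols_transpose_mul_self {k N : ℕ} (hkN : k ≤ N) {M : Matrix (Fin N) (Fin N) ℝ}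
    (hM : M * Mᵀ = 1) : (firstCols hkN M)ᵀ * firstCols hkN M = 1 := by
  have hM' : Mᵀ * M = 1 := mul_eq_one_comm.mp hM
  ext i j
  have h := congrFun (congrFun hM' (Fin.castLE hkN i)) (Fin.castLE hkN j)
  simpa [firstCols, Matrix.mul_apply, Matrix.one_apply] using h

lemma sum_sq_mul_transpose_of_orthonormal {m k N : ℕ} (A : Matrix (Fin m) (Fin k) ℝ)
    {V : Matrix (Fin N) (Fin k) ℝ} (hV : Vᵀ * V = 1) :
    ∑ i, ∑ n, (A * Vᵀ) i n ^ 2 = frobSq A := by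
  have h (i : Fin m) : ∑ n, (A * Vᵀ) i n ^ 2 = ∑ j, A i j ^ 2 := by
    calc ∑ n, (A * Vᵀ) i n ^ 2 = ((A * Vᵀ) * (A * Vᵀ)ᵀ) i i := by
          simp only [Matrix.mul_apply (M := A * Vᵀ), Matrix.transpose_apply (A * Vᵀ), sq]
      _ = (A * Aᵀ) i i := by
          rw [Matrix.transpose_mul, Matrix.transpose_transpose, Matrix.mul_assoc,
            ← Matrix.mul_assoc Vᵀ, hV, Matrix.one_mul]
      _ = _ := by simp only [Matrix.mul_apply, Matrix.transpose_apply, sq]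
  simp only [h, frobSq]

lemma sum_exp_frobInner_signMatrix_le {m k N : ℕ} (A : Matrix (Fin m) (Fin k) ℝ)
    {V : Matrix (Fin N) (Fin k) ℝ} (hV : Vᵀ * V = 1) (τ : ℝ) :
    ∑ g : Fin m × Fin N → ℤˣ, Real.exp (τ * frobInner A (signMatrix g * V)) ≤
      Fintype.card (Fin m × Fin N → ℤˣ) * Real.exp (1 / 2 * (τ ^ 2 / N * frobSq A)) := by
  have h := sum_exp_signs_le (ι := Fin m × Fin N)
    (fun p => τ * (Real.sqrt N)⁻¹ * (A * Vᵀ) p.1 p.2)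
  have h1 : ∑ p : Fin m × Fin N, (τ * (Real.sqrt N)⁻¹ * (A * Vᵀ) p.1 p.2) ^ 2 =
      τ ^ 2 / N * frobSq A := by
    simp_rw [mul_pow, ← Finset.mul_sum, Fintype.sum_prod_type]
    rw [sum_sq_mul_transpose_of_orthonormal A hV, inv_pow, Real.sq_sqrt (Nat.cast_nonneg N),
      div_eq_mul_inv]
  have h2 (g : Fin m × Fin N → ℤˣ) :
      ∑ p : Fin m × Fin N, ((g p : ℤ) : ℝ) * (τ * (Real.sqrt N)⁻¹ * (A * Vᵀ) p.1 p.2) =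
        τ * frobInner A (signMatrix g * V) := by
    simp only [Fintype.sum_prod_type, frobInner, Matrix.mul_apply, Matrix.transpose_apply,
      signMatrix, Matrix.of_apply, Finset.mul_sum]
    refine Finset.sum_congr rfl fun i _ => ?_
    rw [Finset.sum_comm]
    exact Finset.sum_congr rfl fun _ _ => Finset.sum_congr rfl fun _ _ => by ring
  rw [h1] at h
  simpa only [h2] using h

lemma blockEmb_orthogonal_mul {m k N : ℕ} (hmN : m ≤ N) (hkN : k ≤ N)
    {O : Matrix (Fin N) (Fin N) ℝ} {Q : Matrix (Fin m) (Fin N) ℝ}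
    (hO : ∀ i, O (Fin.castLE hmN i) = Q i) (M : Matrix (Fin N) (Fin N) ℝ) :
    blockEmb m k (O * M) = Q * firstCols hkN M := by
  ext i j
  have hi : (i : ℕ) < N := i.2.trans_le hmN
  have hj : (j : ℕ) < N := j.2.trans_le hkN
  simp only [blockEmb, Matrix.of_apply, hi, hj, and_self, dif_pos, Matrix.mul_apply, ← hO,
    firstCols, Matrix.submatrix_apply, id]
  rfl

lemma measurable_entry {N : ℕ} (a b : Fin N) :
    Measurable fun M : Matrix (Fin N) (Fin N) ℝ => M a b :=
  (measurable_pi_apply b).comp (measurable_pi_apply a)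

lemma measurable_blockEmb_entry {m k N : ℕ} (i : Fin m) (j : Fin k) :
    Measurable fun M : Matrix (Fin N) (Fin N) ℝ => blockEmb m k M i j := by
  by_cases h : (i : ℕ) < N ∧ (j : ℕ) < N
  · simpa [blockEmb, h] using measurable_entry _ _
  · simp [blockEmb, h]

lemma measurableSet_frobNorm_lt {m k N : ℕ} (b r : ℝ) (A : Matrix (Fin m) (Fin k) ℝ) :
    MeasurableSet {M : Matrix (Fin N) (Fin N) ℝ | frobNorm (b • blockEmb m k M - A) < r} := by
  refine measurableSet_lt ?_ measurable_const
  refine Measurable.sqrt ?_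
  simp only [frobSq, Matrix.sub_apply, Matrix.smul_apply, smul_eq_mul]
  exact Finset.measurable_fun_sum _ fun i _ => Finset.measurable_fun_sum _ fun j _ =>
    (((measurable_blockEmb_entry i j).const_mul b).sub_const _).pow_const 2

lemma measurable_mul_left_matrix {N : ℕ} (B : Matrix (Fin N) (Fin N) ℝ) :
    Measurable fun M : Matrix (Fin N) (Fin N) ℝ => B * M := by
  refine measurable_pi_lambda _ fun i => measurable_pi_lambda _ fun j => ?_
  simp only [Matrix.mul_apply]
  exact Finset.measurable_fun_sum _ fun n _ => (measurable_entry n j).const_mul _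

lemma measurableSet_orthogonal {N : ℕ} :
    MeasurableSet {M : Matrix (Fin N) (Fin N) ℝ | M * Mᵀ = 1} := by
  have : {M : Matrix (Fin N) (Fin N) ℝ | M * Mᵀ = 1} =
      ⋂ i, ⋂ j, {M | ∑ n, M i n * M j n = (1 : Matrix (Fin N) (Fin N) ℝ) i j} := by
    ext M
    simp only [Set.mem_ofPred_eq, Set.mem_iInter, ← Matrix.ext_iff, Matrix.mul_apply,
      Matrix.transpose_apply]
  rw [this]
  refine MeasurableSet.iInter fun i => MeasurableSet.iInter fun j => ?_
  exact measurableSet_eq_fun (Finset.measurable_fun_sum _ fun n _ =>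
    (measurable_entry i n).mul (measurable_entry j n)) measurable_const

lemma measurable_frobInner_mul_firstCols {m k N : ℕ} (hkN : k ≤ N)
    (A : Matrix (Fin m) (Fin k) ℝ) (H : Matrix (Fin m) (Fin N) ℝ) :
    Measurable fun M : Matrix (Fin N) (Fin N) ℝ => frobInner A (H * firstCols hkN M) := by
  simp only [frobInner, Matrix.mul_apply, firstCols, Matrix.submatrix_apply, id]
  exact Finset.measurable_fun_sum _ fun i _ => Finset.measurable_fun_sum _ fun j _ =>
    (Finset.measurable_fun_sum _ fun n _ =>
      (measurable_entry n (Fin.castLE hkN j)).const_mul _).const_mul _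

/-- Non-asymptotic small-ball estimate for the block of a left-invariant random orthogonal
matrix. -/
lemma measure_frobNorm_lt_le {m k N : ℕ} (hN : 0 < N) (hmN : m ≤ N) (hkN : k ≤ N)
    (ν : Measure (Matrix (Fin N) (Fin N) ℝ)) [IsProbabilityMeasure ν]
    (hν_supp : ν {M | M * Mᵀ = 1} = 1)
    (hν_inv : ∀ B : Matrix (Fin N) (Fin N) ℝ, B * Bᵀ = 1 → ν.map (fun M => B * M) = ν)
    {b : ℝ} (hb : 0 < b) (A : Matrix (Fin m) (Fin k) ℝ) {δ ε η r : ℝ}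
    (hstable : ∀ (S : Matrix (Fin m) (Fin m) ℝ) (W : Matrix (Fin m) (Fin k) ℝ),
      (∀ i j, |S i j - (1 : Matrix (Fin m) (Fin m) ℝ) i j| ≤ ε) → frobNorm (W - A) < r →
      frobSq A - η ≤ frobInner A (S * W))
    (hpolar : ∀ H : Matrix (Fin m) (Fin N) ℝ,
      (∀ i j, |(H * Hᵀ) i j - (1 : Matrix (Fin m) (Fin m) ℝ) i j| ≤ δ) →
      ∃ (S : Matrix (Fin m) (Fin m) ℝ) (Q : Matrix (Fin m) (Fin N) ℝ),
        H = S * Q ∧ Q * Qᵀ = 1 ∧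
        ∀ i j, |S i j - (1 : Matrix (Fin m) (Fin m) ℝ) i j| ≤ ε)
    (hcard : (Fintype.card (Fin m × Fin N → ℤˣ) : ℝ) ≤ 2 * (nearOrthonormalSigns m N δ).card) :
    ν {M | frobNorm (b • blockEmb m k M - A) < r} ≤
      ENNReal.ofReal (2 * Real.exp (-(N / b ^ 2 * (1 / 2 * frobSq A - η)))) := by
  classical
  set E : Set (Matrix (Fin N) (Fin N) ℝ) := {M | frobNorm (b • blockEmb m k M - A) < r} with hE
  have horth : ∀ᵐ M ∂ν, M * Mᵀ = 1 :=
    (mem_ae_iff_prob_eq_one measurableSet_orthogonal).mpr hν_supp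
  have hNpos : (0 : ℝ) < N := by exact_mod_cast hN
  let Y : (Fin m × Fin N → ℤˣ) → Matrix (Fin N) (Fin N) ℝ → ℝ := fun g M =>
    Real.exp (N / b * frobInner A (signMatrix g * firstCols hkN M))
  have hYm (g) : Measurable fun M => ENNReal.ofReal (Y g M) :=
    (((measurable_frobInner_mul_firstCols hkN A _).const_mul _).exp).ennreal_ofReal
  have hgood : ∀ g ∈ nearOrthonormalSigns m N δ,
      ENNReal.ofReal (Real.exp (N / b ^ 2 * (frobSq A - η))) * ν E ≤
        ∫⁻ M, ENNReal.ofReal (Y g M) ∂ν := by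
    intro g hg
    simp only [nearOrthonormalSigns, Finset.mem_filter, Finset.mem_univ, true_and] at hg
    obtain ⟨S, Q, hH, hQ, hS⟩ := hpolar _ hg
    obtain ⟨O, hO, hOQ⟩ := exists_orthogonal_extension_s10 hmN hQ
    have hEeq : ν E = ν ((fun M => O * M) ⁻¹' E) := by
      conv_lhs => rw [← hν_inv O hO]
      exact Measure.map_apply (measurable_mul_left_matrix O) (measurableSet_frobNorm_lt b r A)
    refine le_trans ?_ (mul_meas_ge_le_lintegral (hYm g)
      (ENNReal.ofReal (Real.exp (N / b ^ 2 * (frobSq A - η)))))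
    rw [hEeq]
    gcongr
    intro M hM
    simp only [hE, Set.mem_preimage, Set.mem_ofPred_eq, blockEmb_orthogonal_mul hmN hkN hOQ] at hM
    refine ENNReal.ofReal_le_ofReal (Real.exp_le_exp.mpr ?_)
    have h := hstable S _ hS hM
    rw [Matrix.mul_smul, frobInner_smul, ← Matrix.mul_assoc, ← hH] at h
    calc N / b ^ 2 * (frobSq A - η)
        ≤ N / b ^ 2 * (b * frobInner A (signMatrix g * firstCols hkN M)) := by gcongr
      _ = N / b * frobInner A (signMatrix g * firstCols hkN M) := by field_simp
  have htotal : ∑ g, ∫⁻ M, ENNReal.ofReal (Y g M) ∂ν ≤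
      ENNReal.ofReal (Fintype.card (Fin m × Fin N → ℤˣ) *
        Real.exp (1 / 2 * (N / b ^ 2 * frobSq A))) := by
    rw [← lintegral_finsetSum _ fun g _ => hYm g]
    calc ∫⁻ M, ∑ g, ENNReal.ofReal (Y g M) ∂ν
        ≤ ∫⁻ _, ENNReal.ofReal (Fintype.card (Fin m × Fin N → ℤˣ) *
            Real.exp (1 / 2 * (N / b ^ 2 * frobSq A))) ∂ν := by
          refine lintegral_mono_ae (horth.mono fun M hM => ?_)
          rw [← ENNReal.ofReal_sum_of_nonneg fun g _ => (Real.exp_pos _).le]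
          refine ENNReal.ofReal_le_ofReal ?_
          have h := sum_exp_frobInner_signMatrix_le A (firstCols_transpose_mul_self hkN hM)
            ((N : ℝ) / b)
          have h2 : ((N : ℝ) / b) ^ 2 / N = N / b ^ 2 := by field_simp
          rwa [h2] at h
      _ = _ := by simp
  have hlower : ((nearOrthonormalSigns m N δ).card : ENNReal) *
      (ENNReal.ofReal (Real.exp (N / b ^ 2 * (frobSq A - η))) * ν E) ≤
        ∑ g, ∫⁻ M, ENNReal.ofReal (Y g M) ∂ν := by
    rw [← nsmul_eq_mul]
    exact (Finset.card_nsmul_le_sum _ _ _ hgood).trans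
      (Finset.sum_le_univ_sum_of_nonneg fun _ => zero_le)
  have hmain := hlower.trans htotal
  obtain ⟨p, hp⟩ : ∃ p : NNReal, ν E = p := ⟨_, (ENNReal.coe_toNNReal (measure_ne_top ν E)).symm⟩
  rw [hp, ← ENNReal.ofReal_natCast, ← ENNReal.ofReal_coe_nnreal,
    ← ENNReal.ofReal_mul (Real.exp_pos _).le, ← ENNReal.ofReal_mul (Nat.cast_nonneg _),
    ENNReal.ofReal_le_ofReal_iff (by positivity)] at hmain
  rw [hp, ← ENNReal.ofReal_coe_nnreal]
  refine ENNReal.ofReal_le_ofReal ?_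
  have hcardpos : (0 : ℝ) < (nearOrthonormalSigns m N δ).card := by
    have : (0 : ℝ) < Fintype.card (Fin m × Fin N → ℤˣ) := by exact_mod_cast Fintype.card_pos
    linarith
  have h1 : Real.exp (N / b ^ 2 * (frobSq A - η)) * p ≤
      2 * Real.exp (1 / 2 * (N / b ^ 2 * frobSq A)) := by
    refine le_of_mul_le_mul_left (hmain.trans ?_) hcardpos
    calc _ ≤ 2 * (nearOrthonormalSigns m N δ).card *
          Real.exp (1 / 2 * (N / b ^ 2 * frobSq A)) := by gcongr
      _ = _ := by ring
  rw [mul_comm, ← le_div_iff₀ (Real.exp_pos _), mul_div_assoc, ← Real.exp_sub] at h1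
  refine h1.trans_eq ?_
  congr 2
  ring

lemma exists_frobInner_mul_stable {m k : ℕ} (A : Matrix (Fin m) (Fin k) ℝ) {η : ℝ} (hη : 0 < η) :
    ∃ ε > 0, ∀ (S : Matrix (Fin m) (Fin m) ℝ) (W : Matrix (Fin m) (Fin k) ℝ),
      (∀ i j, |S i j - (1 : Matrix (Fin m) (Fin m) ℝ) i j| ≤ ε) → frobNorm (W - A) < ε →
      frobSq A - η ≤ frobInner A (S * W) := by
  let F : (Fin m → Fin m → ℝ) × (Fin m → Fin k → ℝ) → ℝ := fun p =>
    ∑ i, ∑ j, A i j * ∑ l, p.1 i l * p.2 l j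
  have hF : Continuous F := by fun_prop
  have hF1 : F ((1 : Matrix (Fin m) (Fin m) ℝ), A) = frobSq A := by
    have h (i : Fin m) (j : Fin k) : ∑ l, (1 : Matrix (Fin m) (Fin m) ℝ) i l * A l j = A i j := by
      rw [← Matrix.mul_apply, Matrix.one_mul]
    simp only [F, h, frobSq, sq]
  have hev := (hF.tendsto ((1 : Matrix (Fin m) (Fin m) ℝ), A)).eventually_const_lt
    (show frobSq A - η < _ by rw [hF1]; linarith)
  obtain ⟨ε, hε, hball⟩ := Metric.eventually_nhds_iff.mp hev
  refine ⟨ε / 2, half_pos hε, fun S W hS hW => ?_⟩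
  refine (hball (y := (S, W)) (lt_of_le_of_lt ?_ (half_lt_self hε))).le
  rw [Prod.dist_eq]
  refine max_le ?_ ?_
  · refine (dist_pi_le_iff (by positivity)).2 fun i => (dist_pi_le_iff (by positivity)).2 fun j => ?_
    rw [Real.dist_eq]
    exact hS i j
  · refine (dist_pi_le_iff (by positivity)).2 fun i => (dist_pi_le_iff (by positivity)).2 fun j => ?_
    rw [Real.dist_eq]
    refine le_trans (Real.abs_le_sqrt ?_) hW.le
    calc (W - A) i j ^ 2 ≤ ∑ j', (W - A) i j' ^ 2 :=
          Finset.single_le_sum (f := fun j' => (W - A) i j' ^ 2) (fun _ _ => sq_nonneg _)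
            (Finset.mem_univ j)
      _ ≤ _ := Finset.single_le_sum (f := fun i' => ∑ j', (W - A) i' j' ^ 2)
          (fun _ _ => Finset.sum_nonneg fun _ _ => sq_nonneg _) (Finset.mem_univ i)

lemma tendsto_sq_div_of_isLittleO_sqrt {β : ℕ → ℝ}
    (hβ_o : β =o[atTop] fun N => Real.sqrt N) :
    Tendsto (fun N : ℕ => β N ^ 2 / N) atTop (nhds 0) := by
  have h := hβ_o.tendsto_div_nhds_zero.pow 2
  simpa [div_pow, Real.sq_sqrt] using h

/-- **Weak MDP upper bound for the `m × k` block of a Haar orthogonal matrix**: for every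
`A ∈ ℝ^{m×k}`, `lim_{r→0} limsup_N (β_N²/N)·log ℙ(β_N Z_N ∈ B_r(A)) ≤ -(1/2)‖A‖_F²`
(the limit as `r → 0` is, by monotonicity, the infimum over `r > 0`). Here `μ N` is the
Haar probability measure on `O(N)`, viewed as a measure on `N × N` matrices. -/
theorem stmt_10
    (m k : ℕ)
    (μ : (N : ℕ) → Measure (Matrix (Fin N) (Fin N) ℝ))
    (hμ_prob : ∀ N, IsProbabilityMeasure (μ N))
    (hμ_supp : ∀ N, μ N {A | A * Aᵀ = 1} = 1)
    (hμ_inv : ∀ N (B : Matrix (Fin N) (Fin N) ℝ), B * Bᵀ = 1 →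
      (μ N).map (fun A => B * A) = μ N)
    (β : ℕ → ℝ) (hβ_pos : ∀ N, 0 < β N)
    (hβ_top : Tendsto β atTop atTop)
    (hβ_o : β =o[atTop] fun N => Real.sqrt N)
    (A : Matrix (Fin m) (Fin k) ℝ) :
    ⨅ r ∈ Set.Ioi (0 : ℝ),
        Filter.limsup (fun N => ((β N ^ 2 / N : ℝ) : EReal) *
          ENNReal.log (μ N {M | frobNorm (β N • blockEmb m k M - A) < r})) atTop ≤
      ((-(1 / 2) * frobSq A : ℝ) : EReal) := by
  refine EReal.le_of_forall_lt_iff_le.mp fun z hz => ?_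
  rw [EReal.coe_lt_coe_iff] at hz
  set η : ℝ := (z + 1 / 2 * frobSq A) / 2 with hη
  have hη0 : 0 < η := by rw [hη]; linarith
  obtain ⟨ε, hε, hstable⟩ := exists_frobInner_mul_stable A hη0
  obtain ⟨δ, hδ, hpolar⟩ := exists_polar_of_near_orthonormal m hε
  refine (iInf₂_le ε hε).trans ?_
  have hrate : Tendsto (fun N : ℕ => β N ^ 2 / N * Real.log 2) atTop (nhds 0) := by
    simpa using (tendsto_sq_div_of_isLittleO_sqrt hβ_o).mul_const (Real.log 2)
  refine limsup_le_of_le (h := ?_)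
  filter_upwards [hrate.eventually_le_const hη0, card_le_two_mul_card_nearOrthonormalSigns m hδ,
    eventually_ge_atTop m, eventually_ge_atTop k, eventually_gt_atTop 0]
    with N hrateN hcard hmN hkN hN
  have hb := hβ_pos N
  have hNpos : (0 : ℝ) < N := by exact_mod_cast hN
  have := hμ_prob N
  have hp := measure_frobNorm_lt_le hN hmN hkN (μ N) (hμ_supp N) (hμ_inv N) hb A hstable
    (hpolar N) hcard
  have hlog := ENNReal.log_le_log hp
  rw [ENNReal.log_ofReal_of_pos (by positivity), Real.log_mul two_ne_zero (Real.exp_pos _).ne',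
    Real.log_exp] at hlog
  refine (mul_le_mul_of_nonneg_left hlog (EReal.coe_nonneg.mpr (by positivity))).trans ?_
  rw [← EReal.coe_mul, EReal.coe_le_coe_iff]
  have h1 : β N ^ 2 / N * (Real.log 2 + -(N / β N ^ 2 * (1 / 2 * frobSq A - η))) =
      β N ^ 2 / N * Real.log 2 - (1 / 2 * frobSq A - η) := by
    field_simp
    ring
  rw [h1]
  linarith
end
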